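/- arXiv:1901.07753 — 6 statements merged into one kernel-verified Lean document; each statement's English description precedes it below -/
import Mathlib

section
/- Let m > 0. For all x, y ∈ ℝ² with x ≠ y, the massive Green function admits the decomposition ∫₀^∞ e^{−(m²/2)s − ‖x−y‖²/(2s)} ds/(2s) = ∫₁^∞ k_m(s(x−y))/s ds, where k_m(z) := (1/2)∫₀^∞ e^{−(m²/2s)‖z‖² − s/2} ds. -/
open MeasureTheory

/-- `k_m(z) = (1/2) ∫₀^∞ e^{−(m²/(2s))‖z‖² − s/2} ds`. -/
noncomputable def km (m : ℝ) (z : EuclideanSpace ℝ (Fin 2)) : ℝ :=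
  (1 / 2) * ∫ s in Set.Ioi (0 : ℝ), Real.exp (-(m ^ 2 / (2 * s)) * ‖z‖ ^ 2 - s / 2)

/-- The substitution `s = c / u` on the positive half-line. -/
theorem integral_Ioi_comp_const_div (g : ℝ → ℝ) {c : ℝ} (hc : 0 < c) :
    ∫ u in Set.Ioi (0 : ℝ), c / u ^ 2 * g (c / u) = ∫ s in Set.Ioi (0 : ℝ), g s := by
  have h1 := integral_comp_rpow_Ioi (fun v => g (c * v)) (p := -1) (by norm_num)
  have h2 := integral_comp_mul_left_Ioi g 0 hc
  rw [mul_zero, smul_eq_mul] at h2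
  rw [h2] at h1
  have h3 : ∫ u in Set.Ioi (0 : ℝ), c / u ^ 2 * g (c / u)
      = c * ∫ u in Set.Ioi (0 : ℝ), (|(-1 : ℝ)| * u ^ ((-1 : ℝ) - 1)) • g (c * u ^ (-1 : ℝ)) := by
    rw [← integral_const_mul]
    refine setIntegral_congr_fun measurableSet_Ioi fun u hu => ?_
    have hu : (0 : ℝ) < u := hu
    have e : u ^ ((-1 : ℝ) - 1) = (u ^ 2)⁻¹ := by
      rw [show (-1 : ℝ) - 1 = -((2 : ℕ) : ℝ) by norm_num, Real.rpow_neg hu.le, Real.rpow_natCast]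
    simp only [e, Real.rpow_neg_one, smul_eq_mul, abs_neg, abs_one, one_mul, div_eq_mul_inv]
    ring
  rw [h3, h1, mul_inv_cancel_left₀ hc.ne']

theorem tendsto_neg_mul_exp_neg_mul_sq_atTop (a : ℝ) {b : ℝ} (hb : 0 < b) :
    Filter.Tendsto (fun t : ℝ => -(a * Real.exp (-(b * t ^ 2)))) Filter.atTop (nhds 0) := by
  have h : Filter.Tendsto (fun t : ℝ => b * t ^ 2) Filter.atTop Filter.atTop :=
    (Filter.tendsto_pow_atTop two_ne_zero).const_mul_atTop hb
  simpa using ((Real.tendsto_exp_neg_atTop_nhds_zero.comp h).const_mul a).neg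

theorem hasDerivAt_neg_mul_exp_neg_mul_sq (a b t : ℝ) :
    HasDerivAt (fun t : ℝ => -(a * Real.exp (-(b * t ^ 2))))
      (2 * a * b * t * Real.exp (-(b * t ^ 2))) t := by
  refine HasDerivAt.congr_deriv
    (((((hasDerivAt_pow 2 t).const_mul b).fun_neg.exp).const_mul a).fun_neg) ?_
  push_cast
  ring

theorem integrableOn_Ioi_mul_exp_neg_mul_sq {a b : ℝ} (ha : 0 ≤ a) (hb : 0 < b) :
    IntegrableOn (fun t : ℝ => 2 * a * b * t * Real.exp (-(b * t ^ 2))) (Set.Ioi 1) :=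
  integrableOn_Ioi_deriv_of_nonneg' (fun t _ => hasDerivAt_neg_mul_exp_neg_mul_sq a b t)
    (fun t (ht : 1 < t) => by
      have : 0 < t := zero_lt_one.trans ht
      positivity)
    (tendsto_neg_mul_exp_neg_mul_sq_atTop a hb)

theorem integral_Ioi_mul_exp_neg_mul_sq {a b : ℝ} (ha : 0 ≤ a) (hb : 0 < b) :
    ∫ t in Set.Ioi (1 : ℝ), 2 * a * b * t * Real.exp (-(b * t ^ 2)) = a * Real.exp (-b) := by
  rw [integral_Ioi_of_hasDerivAt_of_tendsto' (fun t _ => hasDerivAt_neg_mul_exp_neg_mul_sq a b t)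
    (integrableOn_Ioi_mul_exp_neg_mul_sq ha hb) (tendsto_neg_mul_exp_neg_mul_sq_atTop a hb)]
  simp

theorem integrableOn_massive_green {m r : ℝ} (hm : 0 < m) (hr : 0 < r) :
    IntegrableOn (fun u : ℝ => Real.exp (-(m ^ 2 / 2) * u - r ^ 2 / (2 * u)) / (2 * u))
      (Set.Ioi 0) := by
  refine Integrable.mono'
    ((exp_neg_integrableOn_Ioi 0 (show 0 < m ^ 2 / 2 by positivity)).const_mul (1 / r ^ 2))
    (Measurable.aestronglyMeasurable (by fun_prop)) ?_
  filter_upwards [ae_restrict_mem measurableSet_Ioi] with u hu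
  have hu : (0 : ℝ) < u := hu
  have hexp : Real.exp (-(r ^ 2 / (2 * u))) ≤ 2 * u / r ^ 2 := by
    have h := Real.add_one_le_exp (r ^ 2 / (2 * u))
    rw [Real.exp_neg, ← inv_div (r ^ 2)]
    exact inv_anti₀ (by positivity) (by linarith)
  rw [Real.norm_of_nonneg (by positivity), sub_eq_add_neg, Real.exp_add, div_le_iff₀ (by positivity)]
  calc _ ≤ Real.exp (-(m ^ 2 / 2) * u) * (2 * u / r ^ 2) := by gcongr
    _ = _ := by ring

/-- Tonelli for the joint integrand of the decomposition. -/
theorem integral_swap_massive_green {m r : ℝ} (hm : 0 < m) (hr : 0 < r) :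
    (∫ t in Set.Ioi (1 : ℝ), ∫ u in Set.Ioi (0 : ℝ),
        t * r ^ 2 / (2 * u ^ 2) * Real.exp (-(m ^ 2 / 2) * u - t ^ 2 * r ^ 2 / (2 * u)))
      = ∫ u in Set.Ioi (0 : ℝ), Real.exp (-(m ^ 2 / 2) * u - r ^ 2 / (2 * u)) / (2 * u) := by
  set F : ℝ → ℝ → ℝ := fun t u =>
    t * r ^ 2 / (2 * u ^ 2) * Real.exp (-(m ^ 2 / 2) * u - t ^ 2 * r ^ 2 / (2 * u)) with hF
  have hslice : ∀ u : ℝ, 0 < u → (fun t => F t u) = fun t =>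
      2 * (Real.exp (-(m ^ 2 / 2) * u) / (2 * u)) * (r ^ 2 / (2 * u)) * t
        * Real.exp (-(r ^ 2 / (2 * u) * t ^ 2)) := by
    intro u hu
    ext t
    rw [hF]
    simp only
    rw [sub_eq_add_neg, Real.exp_add,
      show t ^ 2 * r ^ 2 / (2 * u) = r ^ 2 / (2 * u) * t ^ 2 by ring]
    field_simp
  have hint : ∀ u : ℝ, 0 < u → ∫ t in Set.Ioi (1 : ℝ), F t u
      = Real.exp (-(m ^ 2 / 2) * u - r ^ 2 / (2 * u)) / (2 * u) := by
    intro u hu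
    rw [hslice u hu, integral_Ioi_mul_exp_neg_mul_sq (by positivity) (by positivity),
      sub_eq_add_neg, Real.exp_add]
    ring
  have hmeas : Measurable (Function.uncurry F) := by
    unfold Function.uncurry
    rw [hF]
    fun_prop
  have hprod : Integrable (Function.uncurry F)
      ((volume.restrict (Set.Ioi (1 : ℝ))).prod (volume.restrict (Set.Ioi (0 : ℝ)))) := by
    rw [integrable_prod_iff' hmeas.aestronglyMeasurable]
    constructor
    · filter_upwards [ae_restrict_mem measurableSet_Ioi] with u hu
      have hu : (0 : ℝ) < u := hu
      change Integrable (fun t => F t u) _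
      rw [hslice u hu]
      exact integrableOn_Ioi_mul_exp_neg_mul_sq (by positivity) (by positivity)
    · refine (integrableOn_massive_green hm hr).congr ?_
      filter_upwards [ae_restrict_mem measurableSet_Ioi] with u hu
      rw [← hint u hu]
      refine setIntegral_congr_fun measurableSet_Ioi fun t ht => ?_
      have ht : (1 : ℝ) < t := ht
      have ht0 : 0 < t := by linarith
      exact (Real.norm_of_nonneg (by simp only [hF]; positivity)).symm
  rw [integral_integral_swap hprod]
  exact setIntegral_congr_fun measurableSet_Ioi hint

theorem km_smul_div (m : ℝ) {z : EuclideanSpace ℝ (Fin 2)} (hz : z ≠ 0) {t : ℝ} (ht : 0 < t) :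
    km m (t • z) / t = ∫ u in Set.Ioi (0 : ℝ),
      t * ‖z‖ ^ 2 / (2 * u ^ 2) * Real.exp (-(m ^ 2 / 2) * u - t ^ 2 * ‖z‖ ^ 2 / (2 * u)) := by
  have hr : 0 < ‖z‖ := norm_pos_iff.mpr hz
  have hc : 0 < t ^ 2 * ‖z‖ ^ 2 := by positivity
  rw [km, ← integral_Ioi_comp_const_div _ hc, div_eq_mul_inv, mul_comm, ← mul_assoc,
    ← integral_const_mul]
  refine setIntegral_congr_fun measurableSet_Ioi fun u hu => ?_
  have hu : (0 : ℝ) < u := hu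
  have e : -(m ^ 2 / (2 * (t ^ 2 * ‖z‖ ^ 2 / u))) * ‖t • z‖ ^ 2 - t ^ 2 * ‖z‖ ^ 2 / u / 2
      = -(m ^ 2 / 2) * u - t ^ 2 * ‖z‖ ^ 2 / (2 * u) := by
    rw [norm_smul, Real.norm_of_nonneg ht.le]
    field_simp
  simp only [e]
  field_simp

theorem massive_green_decomposition (m : ℝ) (hm : 0 < m)
    (x y : EuclideanSpace ℝ (Fin 2)) (hxy : x ≠ y) :
    (∫ s in Set.Ioi (0 : ℝ),
        Real.exp (-(m ^ 2 / 2) * s - ‖x - y‖ ^ 2 / (2 * s)) / (2 * s))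
      = ∫ s in Set.Ioi (1 : ℝ), km m (s • (x - y)) / s := by
  have hz : x - y ≠ 0 := sub_ne_zero.mpr hxy
  rw [← integral_swap_massive_green hm (norm_pos_iff.mpr hz)]
  exact setIntegral_congr_fun measurableSet_Ioi fun t ht =>
    (km_smul_div m hz (zero_lt_one.trans ht)).symm
end

section
/- Let m > 0. The kernel (x,y) ↦ k_m(x−y) on ℝ² is of positive type: for every n ∈ ℕ, every choice of points x₁,…,xₙ ∈ ℝ² and real numbers a₁,…,aₙ, one has Σ_{i=1}^n Σ_{j=1}^n a_i a_j k_m(x_i − x_j) ≥ 0, where k_m(z) := (1/2)∫₀^∞ e^{−(m²/2s)‖z‖² − s/2} ds. -/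
open MeasureTheory

/-- The real part of the characteristic function of a finite measure is of positive type. -/
theorem sum_mul_re_charFun_sub_nonneg {E ι : Type*} [NormedAddCommGroup E]
    [InnerProductSpace ℝ E] [MeasurableSpace E] [OpensMeasurableSpace E] [Fintype ι]
    (μ : Measure E) [IsFiniteMeasure μ] (t : ι → E) (a : ι → ℝ) :
    0 ≤ ∑ i, ∑ j, a i * a j * (charFun μ (t i - t j)).re := by
  have integrable_cos (w : E) : Integrable (fun v ↦ Real.cos (inner ℝ v w)) μ := by
    refine Integrable.of_bound (Continuous.measurable (by fun_prop)).aestronglyMeasurable 1 ?_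
    exact .of_forall fun v ↦ Real.abs_cos_le_one _
  have re_charFun (w : E) : (charFun μ w).re = ∫ v, Real.cos (inner ℝ v w) ∂μ := by
    rw [charFun_apply]
    have hint : Integrable (fun v ↦ Complex.exp (inner ℝ v w * Complex.I)) μ := by
      refine Integrable.of_bound (Continuous.measurable (by fun_prop)).aestronglyMeasurable 1 ?_
      exact .of_forall fun v ↦ (Complex.norm_exp_ofReal_mul_I _).le
    rw [← RCLike.re_eq_complex_re, ← integral_re hint]
    simp [Complex.exp_ofReal_mul_I_re]
  simp_rw [re_charFun, ← integral_const_mul]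
  have (i : ι) : ∑ j, ∫ v, a i * a j * Real.cos (inner ℝ v (t i - t j)) ∂μ =
      ∫ v, ∑ j, a i * a j * Real.cos (inner ℝ v (t i - t j)) ∂μ :=
    (integral_finsetSum _ fun j _ ↦ (integrable_cos _).const_mul _).symm
  simp_rw [this]
  rw [← integral_finsetSum _ fun i _ ↦
    integrable_finsetSum _ fun j _ ↦ (integrable_cos _).const_mul _]
  refine integral_nonneg fun v ↦ ?_
  have key : ∑ i, ∑ j, a i * a j * Real.cos (inner ℝ v (t i - t j)) =
      (∑ i, a i * Real.cos (inner ℝ v (t i))) ^ 2 +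
        (∑ i, a i * Real.sin (inner ℝ v (t i))) ^ 2 := by
    simp_rw [sq, Finset.sum_mul_sum, ← Finset.sum_add_distrib, inner_sub_right, Real.cos_sub]
    refine Finset.sum_congr rfl fun i _ ↦ Finset.sum_congr rfl fun j _ ↦ ?_
    ring
  simp only [Pi.zero_apply, key]
  positivity

/-- Gaussian kernels are of positive type. -/
theorem sum_mul_exp_neg_mul_norm_sub_sq_nonneg {E ι : Type*} [NormedAddCommGroup E]
    [InnerProductSpace ℝ E] [FiniteDimensional ℝ E] [Fintype ι]
    {c : ℝ} (hc : 0 ≤ c) (t : ι → E) (a : ι → ℝ) :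
    0 ≤ ∑ i, ∑ j, a i * a j * Real.exp (-c * ‖t i - t j‖ ^ 2) := by
  borelize E
  convert sum_mul_re_charFun_sub_nonneg (ProbabilityTheory.stdGaussian E)
    (fun i ↦ √(2 * c) • t i) a using 6 with i _ j _
  have hexp : -‖√(2 * c) • t i - √(2 * c) • t j‖ ^ 2 / 2 = -c * ‖t i - t j‖ ^ 2 := by
    rw [← smul_sub, norm_smul, mul_pow, Real.norm_eq_abs, sq_abs, Real.sq_sqrt (by positivity)]
    ring
  rw [ProbabilityTheory.charFun_stdGaussian, ← hexp, ← Complex.exp_ofReal_re]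
  push_cast
  rfl

theorem integrableOn_km_integrand (m : ℝ) (z : EuclideanSpace ℝ (Fin 2)) :
    IntegrableOn (fun s ↦ Real.exp (-(m ^ 2 / (2 * s)) * ‖z‖ ^ 2 - s / 2)) (Set.Ioi 0) := by
  have hdom : IntegrableOn (fun s : ℝ ↦ Real.exp (-(1 / 2) * s)) (Set.Ioi 0) :=
    integrableOn_exp_mul_Ioi (by norm_num) 0
  refine Integrable.mono' hdom (Measurable.aestronglyMeasurable (by fun_prop)) ?_
  refine (ae_restrict_iff' measurableSet_Ioi).2 (.of_forall fun s (hs : 0 < s) ↦ ?_)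
  rw [Real.norm_eq_abs, Real.abs_exp, Real.exp_le_exp]
  have : 0 ≤ m ^ 2 / (2 * s) * ‖z‖ ^ 2 := by positivity
  linarith

theorem km_positive_type (m : ℝ) (hm : 0 < m) (n : ℕ)
    (x : Fin n → EuclideanSpace ℝ (Fin 2)) (a : Fin n → ℝ) :
    0 ≤ ∑ i : Fin n, ∑ j : Fin n, a i * a j * km m (x i - x j) := by
  have hkm : ∑ i, ∑ j, a i * a j * km m (x i - x j) =
      (1 / 2) * ∫ s in Set.Ioi (0 : ℝ), ∑ i, ∑ j, a i * a j *
        Real.exp (-(m ^ 2 / (2 * s)) * ‖x i - x j‖ ^ 2 - s / 2) := by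
    rw [integral_finsetSum _ fun i _ ↦ integrable_finsetSum _ fun j _ ↦
      (integrableOn_km_integrand m (x i - x j)).const_mul _, Finset.mul_sum]
    refine Finset.sum_congr rfl fun i _ ↦ ?_
    rw [integral_finsetSum _ fun j _ ↦
      (integrableOn_km_integrand m (x i - x j)).const_mul _, Finset.mul_sum]
    refine Finset.sum_congr rfl fun j _ ↦ ?_
    rw [integral_const_mul, km]
    ring
  rw [hkm]
  refine mul_nonneg (by norm_num) (setIntegral_nonneg measurableSet_Ioi fun s (hs : 0 < s) ↦ ?_)
  simp_rw [Real.exp_sub, ← mul_div_assoc, ← Finset.sum_div]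
  exact div_nonneg (sum_mul_exp_neg_mul_norm_sub_sq_nonneg (by positivity) x a) (Real.exp_pos _).le
end

section
/- Let μ be a positive Radon (locally finite Borel) measure on ℝ² such that there exist constants α > 0, C > 0 and r₀ ∈ (0,1] with μ(B(x,r)) ≤ C r^α for every x ∈ ℝ² and every r ∈ (0, r₀]. Then the map x ↦ ∫_{ℝ²} log₊(1/‖x−y‖) μ(dy) is continuous on ℝ². -/
open MeasureTheory
open scoped ENNReal

open Filter Topology Set in
/-- Layer-cake bound: polynomial decay of the mass of balls makes the logarithmic potential
localised at scale `δ` of order `δ ^ α`. -/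
theorem lintegral_posLog_le_of_ball_le {E : Type*} [NormedAddCommGroup E] [MeasurableSpace E]
    [BorelSpace E] {μ : Measure E} {α C δ : ℝ} (hα : 0 < α) (hC : 0 ≤ C) (hδ : 0 < δ) {x : E}
    (hball : ∀ r : ℝ, 0 < r → r ≤ δ → μ (Metric.ball x r) ≤ ENNReal.ofReal (C * r ^ α)) :
    ∫⁻ y, ENNReal.ofReal (max (Real.log (δ / ‖x - y‖)) 0) ∂μ
      ≤ ENNReal.ofReal (C * δ ^ α / α) := by
  have hmeas : Measurable fun y : E => max (Real.log (δ / ‖x - y‖)) 0 := by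
    have : Measurable fun y : E => ‖x - y‖ :=
      (continuous_const.sub continuous_id).norm.measurable
    fun_prop
  rw [lintegral_eq_lintegral_meas_lt μ
    (f := fun y => max (Real.log (δ / ‖x - y‖)) 0) (Eventually.of_forall fun y => le_max_right _ _)
    hmeas.aemeasurable]
  have hint : IntegrableOn (fun t : ℝ => C * δ ^ α * Real.exp (-α * t)) (Ioi 0) :=
    (exp_neg_integrableOn_Ioi 0 hα).const_mul _
  calc
    ∫⁻ t in Ioi (0 : ℝ), μ {y | t < max (Real.log (δ / ‖x - y‖)) 0}
        ≤ ∫⁻ t in Ioi (0 : ℝ), ENNReal.ofReal (C * δ ^ α * Real.exp (-α * t)) := by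
      refine setLIntegral_mono' measurableSet_Ioi fun t ht => ?_
      have ht : 0 < t := ht
      have hsub : {y | t < max (Real.log (δ / ‖x - y‖)) 0}
          ⊆ Metric.ball x (δ * Real.exp (-t)) := by
        intro y hy
        have hlog : t < Real.log (δ / ‖x - y‖) :=
          (lt_max_iff.1 hy).resolve_right ht.le.not_gt
        have hxy : 0 < ‖x - y‖ := by
          refine (norm_nonneg _).lt_of_ne fun h => ?_
          rw [← h] at hlog
          simp only [div_zero, Real.log_zero] at hlog
          linarith
        rw [Real.lt_log_iff_exp_lt (by positivity), lt_div_iff₀ hxy] at hlog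
        rw [Metric.mem_ball', dist_eq_norm, Real.exp_neg, ← div_eq_mul_inv,
          lt_div_iff₀ (Real.exp_pos t), mul_comm]
        exact hlog
      refine (measure_mono hsub).trans ((hball _ (by positivity) ?_).trans_eq ?_)
      · exact mul_le_of_le_one_right hδ.le (Real.exp_le_one_iff.2 (by linarith))
      · rw [Real.mul_rpow hδ.le (Real.exp_pos _).le, ← Real.exp_mul, mul_assoc]
        congr 4
        ring
    _ = ENNReal.ofReal (C * δ ^ α / α) := by
      rw [← ofReal_integral_eq_lintegral_ofReal hint
        (Eventually.of_forall fun t => by positivity), integral_const_mul,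
        integral_exp_mul_Ioi (neg_lt_zero.2 hα)]
      congr 1
      simp
      ring

/-- Splitting of `log₊ (1 / t)` at scale `δ`. -/
theorem max_log_one_div_eq_add {δ t : ℝ} (hδ : 0 < δ) (hδ1 : δ ≤ 1) (ht : 0 < t) :
    max (Real.log (1 / t)) 0
      = max (-Real.log (max t δ)) 0 + max (Real.log (δ / t)) 0 := by
  have hlogδ : Real.log δ ≤ 0 := Real.log_nonpos hδ.le hδ1
  rw [Real.log_div one_ne_zero ht.ne', Real.log_div hδ.ne' ht.ne', Real.log_one, zero_sub]
  rcases le_total t δ with h | h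
  · have := Real.log_le_log ht h
    rw [max_eq_right h, max_eq_left (by linarith), max_eq_left (by linarith),
      max_eq_left (by linarith)]
    ring
  · have := Real.log_le_log hδ h
    rw [max_eq_left h, max_eq_right (b := (0 : ℝ)) (a := Real.log δ - Real.log t) (by linarith),
      add_zero]

/-- The truncated logarithmic kernel, of support in the unit ball, is dominated on a neighbourhood
of `x₀` by a multiple of the indicator of a fixed ball. -/
theorem norm_max_neg_log_max_le_indicator {E : Type*} [NormedAddCommGroup E] {δ : ℝ} (hδ : 0 < δ)
    (hδ1 : δ ≤ 1) {x₀ x : E} (hx : x ∈ Metric.ball x₀ 1) (y : E) :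
    ‖max (-Real.log (max ‖x - y‖ δ)) 0‖
      ≤ (Metric.closedBall x₀ 2).indicator (fun _ => -Real.log δ) y := by
  have hlogδ : Real.log δ ≤ 0 := Real.log_nonpos hδ.le hδ1
  rw [Real.norm_of_nonneg (le_max_right _ _)]
  by_cases hy : y ∈ Metric.closedBall x₀ 2
  · rw [Set.indicator_of_mem hy]
    have := Real.log_le_log hδ (le_max_right ‖x - y‖ δ)
    exact max_le (by linarith) (by linarith)
  · rw [Set.indicator_of_notMem hy]
    have h1 : 1 ≤ ‖x - y‖ := by
      rw [Metric.mem_closedBall, not_le] at hy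
      rw [Metric.mem_ball] at hx
      have := dist_triangle y x x₀
      rw [← dist_eq_norm, dist_comm]
      linarith
    have := Real.log_nonneg (h1.trans (le_max_left _ δ))
    exact max_le (by linarith) le_rfl

theorem continuous_max_neg_log_max_norm_sub {E : Type*} [NormedAddCommGroup E] {δ : ℝ}
    (hδ : 0 < δ) :
    Continuous fun p : E × E => max (-Real.log (max ‖p.1 - p.2‖ δ)) 0 :=
  ((((continuous_fst.sub continuous_snd).norm.max continuous_const).log
    fun _ => (lt_max_of_lt_right hδ).ne').neg).max continuous_const

section Truncated

variable {E : Type*} [NormedAddCommGroup E] [ProperSpace E] [MeasurableSpace E] [BorelSpace E]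
  (μ : Measure E) [IsLocallyFiniteMeasure μ] {δ : ℝ}

theorem integrable_indicator_closedBall_const (x₀ : E) (R c : ℝ) :
    Integrable ((Metric.closedBall x₀ R).indicator fun _ => c) μ :=
  (integrable_indicator_iff Metric.isClosed_closedBall.measurableSet).2
    (integrableOn_const (isCompact_closedBall x₀ R).measure_lt_top.ne)

theorem integrable_max_neg_log_max_norm_sub (hδ : 0 < δ) (hδ1 : δ ≤ 1) (x : E) :
    Integrable (fun y => max (-Real.log (max ‖x - y‖ δ)) 0) μ :=
  (integrable_indicator_closedBall_const μ x 2 (-Real.log δ)).mono'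
    ((continuous_max_neg_log_max_norm_sub hδ).comp
      (Continuous.prodMk_right x)).aestronglyMeasurable
    (Filter.Eventually.of_forall
      (norm_max_neg_log_max_le_indicator hδ hδ1 (Metric.mem_ball_self one_pos)))

theorem continuous_integral_max_neg_log_max_norm_sub (hδ : 0 < δ) (hδ1 : δ ≤ 1) :
    Continuous fun x : E => ∫ y, max (-Real.log (max ‖x - y‖ δ)) 0 ∂μ := by
  refine continuous_iff_continuousAt.2 fun x₀ => continuousAt_of_dominated
    (Filter.Eventually.of_forall fun x =>
      (integrable_max_neg_log_max_norm_sub μ hδ hδ1 x).aestronglyMeasurable) ?_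
    (integrable_indicator_closedBall_const μ x₀ 2 (-Real.log δ))
    (Filter.Eventually.of_forall fun y => ?_)
  · filter_upwards [Metric.ball_mem_nhds x₀ one_pos] with x hx
    exact Filter.Eventually.of_forall (norm_max_neg_log_max_le_indicator hδ hδ1 hx)
  · exact ((continuous_max_neg_log_max_norm_sub hδ).comp
      (Continuous.prodMk_left y)).continuousAt

end Truncated

open Filter Topology in
theorem tendsto_const_mul_rpow_div_nhdsGT_zero {α : ℝ} (hα : 0 < α) (C c : ℝ) :
    Tendsto (fun r : ℝ => C * r ^ α / c) (𝓝[>] 0) (𝓝 0) := by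
  have h : Tendsto (fun r : ℝ => C * r ^ α / c) (𝓝 0) (𝓝 (C * 0 ^ α / c)) :=
    (((Real.continuousAt_rpow_const 0 α (Or.inr hα.le)).tendsto).const_mul C).div_const c
  rw [Real.zero_rpow hα.ne', mul_zero, zero_div] at h
  exact h.mono_left nhdsWithin_le_nhds

open Filter Topology in
theorem measure_singleton_eq_zero_of_ball_le {X : Type*} [PseudoMetricSpace X]
    [MeasurableSpace X] {μ : Measure X} {α C r₀ : ℝ} (hα : 0 < α) (hr₀ : 0 < r₀) {x : X}
    (hball : ∀ r : ℝ, 0 < r → r ≤ r₀ → μ (Metric.ball x r) ≤ ENNReal.ofReal (C * r ^ α)) :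
    μ {x} = 0 := by
  have h := ENNReal.tendsto_ofReal (tendsto_const_mul_rpow_div_nhdsGT_zero hα C 1)
  rw [ENNReal.ofReal_zero] at h
  refine le_antisymm (ge_of_tendsto h ?_) zero_le
  filter_upwards [Ioc_mem_nhdsGT hr₀] with r hr
  rw [div_one]
  exact (measure_mono (Set.singleton_subset_iff.2 (Metric.mem_ball_self hr.1))).trans
    (hball r hr.1 hr.2)

theorem log_potential_continuous (μ : Measure (EuclideanSpace ℝ (Fin 2)))
    [IsLocallyFiniteMeasure μ] (α C r₀ : ℝ) (hα : 0 < α) (hC : 0 < C)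
    (hr₀ : 0 < r₀) (hr₀1 : r₀ ≤ 1)
    (hball : ∀ (x : EuclideanSpace ℝ (Fin 2)) (r : ℝ), 0 < r → r ≤ r₀ →
      μ (Metric.ball x r) ≤ ENNReal.ofReal (C * r ^ α)) :
    Continuous (fun x : EuclideanSpace ℝ (Fin 2) =>
      ∫ y, max (Real.log (1 / ‖x - y‖)) 0 ∂μ) := by
  refine continuous_of_uniform_approx_of_continuous fun u hu => ?_
  obtain ⟨ε, hε, hεu⟩ := Metric.mem_uniformity_dist.1 hu
  obtain ⟨δ, hδε, hδ, hδr₀⟩ :=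
    (((tendsto_const_mul_rpow_div_nhdsGT_zero hα C α).eventually_lt_const hε).and
      (Ioc_mem_nhdsGT hr₀)).exists
  have hδ1 : δ ≤ 1 := hδr₀.trans hr₀1
  refine ⟨_, continuous_integral_max_neg_log_max_norm_sub μ hδ hδ1, fun x => hεu ?_⟩
  have hle := lintegral_posLog_le_of_ball_le hα hC.le hδ (μ := μ) (x := x)
    fun r hr hrδ => hball x r hr (hrδ.trans hδr₀)
  have hmeas : Measurable fun y : EuclideanSpace ℝ (Fin 2) =>
      max (Real.log (δ / ‖x - y‖)) 0 := by fun_prop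
  have hnonneg : ∀ y, 0 ≤ max (Real.log (δ / ‖x - y‖)) 0 := fun y => le_max_right _ _
  have hint : Integrable (fun y => max (Real.log (δ / ‖x - y‖)) 0) μ :=
    ⟨hmeas.aestronglyMeasurable, (hasFiniteIntegral_iff_ofReal (.of_forall hnonneg)).2
      (hle.trans_lt ENNReal.ofReal_lt_top)⟩
  have hsplit : ∀ᵐ y ∂μ, max (Real.log (1 / ‖x - y‖)) 0
      = max (-Real.log (max ‖x - y‖ δ)) 0 + max (Real.log (δ / ‖x - y‖)) 0 := by
    have hne : ∀ᵐ y ∂μ, y ≠ x := by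
      simpa [ae_iff] using measure_singleton_eq_zero_of_ball_le hα hr₀ (hball x)
    filter_upwards [hne] with y hy
    exact max_log_one_div_eq_add hδ hδ1 (norm_pos_iff.2 (sub_ne_zero.2 hy.symm))
  rw [integral_congr_ae hsplit,
    integral_add (integrable_max_neg_log_max_norm_sub μ hδ hδ1 x) hint, Real.dist_eq,
    add_sub_cancel_left, abs_of_nonneg (integral_nonneg hnonneg),
    integral_eq_lintegral_of_nonneg_ae (.of_forall hnonneg) hmeas.aestronglyMeasurable]
  exact (ENNReal.toReal_le_of_le_ofReal (by positivity) hle).trans_lt hδε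
end

section
/- Let μ be a positive Radon (locally finite Borel) measure on ℝ² such that the map x ↦ ∫_{ℝ²} log₊(1/‖x−y‖) μ(dy) is finite and continuous on ℝ². Then for every compact set E ⊂ ℝ² there exist constants c₁, c₂ > 0 such that for every x ∈ ℝ², ∫_E r₁(x,y) μ(dy) ≤ c₁ ∫_{ℝ²} log₊(1/‖x−y‖) μ(dy) + c₂ μ(E); in particular, the potential x ↦ ∫_E r₁(x,y) μ(dy) is bounded above everywhere on ℝ² by a continuous function. -/
open MeasureTheory
open scoped ENNReal

/-- The 1-resolvent kernel of planar Brownian motion: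
`r₁(x,y) = ∫₀^∞ e^{−t} (2πt)^{−1} e^{−‖x−y‖²/(2t)} dt`. -/
noncomputable def resolventKernel (x y : EuclideanSpace ℝ (Fin 2)) : ℝ≥0∞ :=
  ∫⁻ t in Set.Ioi (0 : ℝ),
    ENNReal.ofReal (Real.exp (-t) * (2 * Real.pi * t)⁻¹ * Real.exp (-‖x - y‖ ^ 2 / (2 * t)))

/-- A near-diagonal logarithmic bound for the `1`-resolvent kernel, valid off the diagonal. -/
theorem resolventKernel_le {x y : EuclideanSpace ℝ (Fin 2)} (hxy : x ≠ y) :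
    resolventKernel x y ≤
      ENNReal.ofReal (2 * max (Real.log (1 / ‖x - y‖)) 0) + ENNReal.ofReal 3 := by
  have hr : 0 < ‖x - y‖ := norm_pos_iff.mpr (sub_ne_zero.mpr hxy)
  unfold resolventKernel
  generalize ‖x - y‖ = r at hr
  set a : ℝ := r ^ 2 / 2 with ha
  have ha0 : 0 < a := by positivity
  have hpi : 1 ≤ 2 * Real.pi := by linarith [Real.pi_gt_three]
  have small : ∫⁻ t in Set.Ioc (0 : ℝ) 1,
      ENNReal.ofReal (Real.exp (-t) * (2 * Real.pi * t)⁻¹ * Real.exp (-r ^ 2 / (2 * t))) ≤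
        ENNReal.ofReal (Real.log ((1 + a) / a)) := by
    have hint : IntervalIntegrable (fun t : ℝ => (t + a)⁻¹) volume 0 1 := by
      apply ContinuousOn.intervalIntegrable
      apply ContinuousOn.inv₀ (by fun_prop)
      intro t ht
      rw [Set.uIcc_of_le zero_le_one] at ht
      linarith [ht.1]
    have hval : ∫ t in Set.Ioc (0 : ℝ) 1, (t + a)⁻¹ = Real.log ((1 + a) / a) := by
      rw [← intervalIntegral.integral_of_le zero_le_one,
        intervalIntegral.integral_comp_add_right (fun t : ℝ => t⁻¹), zero_add,
        integral_inv_of_pos ha0 (by linarith)]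
    rw [← hval, ofReal_integral_eq_lintegral_ofReal
      ((intervalIntegrable_iff_integrableOn_Ioc_of_le zero_le_one).mp hint)]
    · refine setLIntegral_mono' measurableSet_Ioc fun t ht => ENNReal.ofReal_le_ofReal ?_
      have ht0 : 0 < t := ht.1
      have h1 : Real.exp (-t) ≤ 1 := Real.exp_le_one_iff.mpr (by linarith)
      have h2 : (2 * Real.pi * t)⁻¹ ≤ t⁻¹ := by
        apply inv_anti₀ ht0
        nlinarith
      have h3 : Real.exp (-r ^ 2 / (2 * t)) ≤ (1 + a / t)⁻¹ := by
        rw [show -r ^ 2 / (2 * t) = -(a / t) by rw [ha]; field_simp, Real.exp_neg]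
        apply inv_anti₀ (by positivity)
        linarith [Real.add_one_le_exp (a / t)]
      calc _ ≤ 1 * t⁻¹ * (1 + a / t)⁻¹ := by gcongr
        _ = (t + a)⁻¹ := by field_simp
    · refine (ae_restrict_mem measurableSet_Ioc).mono fun t ht => ?_
      have : 0 < t := ht.1
      show 0 ≤ (t + a)⁻¹
      positivity
  have large : ∫⁻ t in Set.Ioi (1 : ℝ),
      ENNReal.ofReal (Real.exp (-t) * (2 * Real.pi * t)⁻¹ * Real.exp (-r ^ 2 / (2 * t))) ≤
        ENNReal.ofReal 1 := by
    have hval : ∫ t in Set.Ioi (1 : ℝ), Real.exp (-t) ≤ 1 := by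
      rw [integral_exp_neg_Ioi]
      exact Real.exp_le_one_iff.mpr (by norm_num)
    refine le_trans ?_ (ENNReal.ofReal_le_ofReal hval)
    rw [ofReal_integral_eq_lintegral_ofReal (integrableOn_exp_neg_Ioi 1)
      (ae_of_all _ fun t => (Real.exp_pos _).le)]
    refine setLIntegral_mono' measurableSet_Ioi fun t ht => ENNReal.ofReal_le_ofReal ?_
    have ht1 : 1 < t := ht
    have ht0 : 0 < t := by linarith
    have h2 : (2 * Real.pi * t)⁻¹ ≤ 1 := inv_le_one_of_one_le₀ (by nlinarith)
    have h3 : Real.exp (-r ^ 2 / (2 * t)) ≤ 1 := by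
      rw [Real.exp_le_one_iff, neg_div]
      exact neg_nonpos.mpr (by positivity)
    calc _ ≤ Real.exp (-t) * 1 * 1 := by gcongr
      _ = Real.exp (-t) := by ring
  have hlog : Real.log ((1 + a) / a) ≤ 2 * max (Real.log (1 / r)) 0 + 2 := by
    have h3 : Real.log 3 ≤ 2 := by
      linarith [Real.log_le_sub_one_of_pos (show (0 : ℝ) < 3 by norm_num)]
    rcases le_total r 1 with h | h
    · have : (1 + a) / a ≤ 3 * (1 / r) ^ 2 := by
        rw [ha, div_le_iff₀ (by positivity)]
        field_simp
        nlinarith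
      have h4 := Real.log_le_log (by positivity) this
      rw [Real.log_mul (by norm_num) (by positivity), Real.log_pow] at h4
      push_cast at h4
      linarith [le_max_left (Real.log (1 / r)) 0]
    · have : (1 + a) / a ≤ 3 := by
        rw [div_le_iff₀ ha0, ha]
        nlinarith
      have h4 := Real.log_le_log (by positivity) this
      linarith [le_max_right (Real.log (1 / r)) 0]
  rw [← Set.Ioc_union_Ioi_eq_Ioi (zero_le_one' ℝ),
    lintegral_union measurableSet_Ioi (Set.Ioc_disjoint_Ioi le_rfl)]
  refine (add_le_add small large).trans ?_
  have hm := le_max_right (Real.log (1 / r)) 0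
  rw [← ENNReal.ofReal_add (Real.log_nonneg ((one_le_div ha0).mpr (by linarith))) zero_le_one,
    ← ENNReal.ofReal_add (by positivity) (by norm_num)]
  exact ENNReal.ofReal_le_ofReal (by linarith)

/-- A measure with continuous logarithmic potential gives no mass to singletons. -/
theorem nullSingletonClass_of_continuous_log_potential (μ : Measure (EuclideanSpace ℝ (Fin 2)))
    [IsLocallyFiniteMeasure μ]
    (hint : ∀ x : EuclideanSpace ℝ (Fin 2),
      Integrable (fun y => max (Real.log (1 / ‖x - y‖)) 0) μ)
    (hcont : Continuous (fun x : EuclideanSpace ℝ (Fin 2) =>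
      ∫ y, max (Real.log (1 / ‖x - y‖)) 0 ∂μ)) :
    NullSingletonClass μ := by
  refine ⟨fun z => ?_⟩
  by_contra hz
  have hm : 0 < μ.real {z} :=
    ENNReal.toReal_pos hz (isCompact_singleton.measure_lt_top).ne
  have hlim : Filter.Tendsto (fun x => μ.real {z} * Real.log (1 / ‖x - z‖))
      (nhdsWithin z {z}ᶜ) Filter.atTop := by
    refine Filter.Tendsto.const_mul_atTop hm (Real.tendsto_log_atTop.comp ?_)
    simp only [one_div]
    exact tendsto_inv_nhdsGT_zero.comp (tendsto_norm_sub_self_nhdsNE z)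
  have hle : ∀ x, μ.real {z} * Real.log (1 / ‖x - z‖) ≤
      ∫ y, max (Real.log (1 / ‖x - y‖)) 0 ∂μ := by
    intro x
    have h1 := setIntegral_le_integral (s := {z}) (hint x)
      (ae_of_all _ fun y => le_max_right _ _)
    rw [integral_singleton, smul_eq_mul] at h1
    exact (mul_le_mul_of_nonneg_left (le_max_left _ _) hm.le).trans h1
  exact not_tendsto_nhds_of_tendsto_atTop (Filter.tendsto_atTop_mono hle hlim) _
    (hcont.continuousAt.tendsto.mono_left nhdsWithin_le_nhds)

theorem potential_dominated_by_continuous (μ : Measure (EuclideanSpace ℝ (Fin 2)))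
    [IsLocallyFiniteMeasure μ]
    (hint : ∀ x : EuclideanSpace ℝ (Fin 2),
      Integrable (fun y => max (Real.log (1 / ‖x - y‖)) 0) μ)
    (hcont : Continuous (fun x : EuclideanSpace ℝ (Fin 2) =>
      ∫ y, max (Real.log (1 / ‖x - y‖)) 0 ∂μ)) :
    ∀ E : Set (EuclideanSpace ℝ (Fin 2)), IsCompact E →
      ∃ c₁ c₂ : ℝ, 0 < c₁ ∧ 0 < c₂ ∧
        ∀ x : EuclideanSpace ℝ (Fin 2),
          (∫⁻ y in E, resolventKernel x y ∂μ) ≤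
            ENNReal.ofReal (c₁ * (∫ y, max (Real.log (1 / ‖x - y‖)) 0 ∂μ)
              + c₂ * (μ E).toReal) := by
  intro E hE
  refine ⟨2, 3, by norm_num, by norm_num, fun x => ?_⟩
  have := nullSingletonClass_of_continuous_log_potential μ hint hcont
  have hne : ∀ᵐ y ∂μ.restrict E, x ≠ y := by
    refine ae_restrict_of_ae ?_
    filter_upwards [Set.Countable.ae_notMem (Set.countable_singleton x) μ] with y hy h
    exact hy h.symm
  have hnn : ∀ y, 0 ≤ 2 * max (Real.log (1 / ‖x - y‖)) 0 := fun y =>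
    mul_nonneg zero_le_two (le_max_right _ _)
  have hpot : 0 ≤ 2 * ∫ y, max (Real.log (1 / ‖x - y‖)) 0 ∂μ :=
    mul_nonneg zero_le_two (integral_nonneg fun y => le_max_right _ _)
  calc ∫⁻ y in E, resolventKernel x y ∂μ
      ≤ ∫⁻ y in E, (ENNReal.ofReal (2 * max (Real.log (1 / ‖x - y‖)) 0)
          + ENNReal.ofReal 3) ∂μ := lintegral_mono_ae (hne.mono fun y hy => resolventKernel_le hy)
    _ = ∫⁻ y in E, ENNReal.ofReal (2 * max (Real.log (1 / ‖x - y‖)) 0) ∂μ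
          + ENNReal.ofReal 3 * μ E := by
        rw [lintegral_add_right _ measurable_const, setLIntegral_const]
    _ ≤ ∫⁻ y, ENNReal.ofReal (2 * max (Real.log (1 / ‖x - y‖)) 0) ∂μ
          + ENNReal.ofReal 3 * μ E := by
        gcongr
        exact Measure.restrict_le_self
    _ = ENNReal.ofReal (2 * (∫ y, max (Real.log (1 / ‖x - y‖)) 0 ∂μ)
          + 3 * (μ E).toReal) := by
        rw [← ofReal_integral_eq_lintegral_ofReal ((hint x).const_mul 2) (ae_of_all _ hnn),
          integral_const_mul, ENNReal.ofReal_add hpot (by positivity),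
          ENNReal.ofReal_mul (by norm_num : (0 : ℝ) ≤ 3),
          ENNReal.ofReal_toReal hE.measure_lt_top.ne]
end

section
/- Let μ be a positive Radon (locally finite Borel) measure on ℝ² such that the map x ↦ ∫_{ℝ²} log₊(1/‖x−y‖) μ(dy) is finite and continuous on ℝ². Then for every compact set G ⊂ ℝ² there exists a constant c > 0 such that for every smooth compactly supported function f ∈ C_c^∞(ℝ²), ∫_G |f(x)| μ(dx) ≤ c · ( (1/2)∫_{ℝ²} ‖∇f(x)‖² dx + ∫_{ℝ²} f(x)² dx )^{1/2}. -/
open MeasureTheory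
open scoped ENNReal

/-- The density at distance `r` of the measure `s ^ (-2) · volume` on a ball of radius `s`. -/
noncomputable def ballWeight (s r : ℝ) : ℝ≥0∞ :=
  if r < s then ENNReal.ofReal ((s ^ 2)⁻¹) else 0

/-- The superposition of the weighted balls of radius at most one. -/
noncomputable def radialKernel (r : ℝ) : ℝ≥0∞ :=
  ∫⁻ s in Set.Ioc (0 : ℝ) 1, ballWeight s r

lemma measurable_ballWeight : Measurable (fun p : ℝ × ℝ => ballWeight p.1 p.2) :=
  Measurable.ite (measurableSet_lt measurable_snd measurable_fst) (by fun_prop) (by fun_prop)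

lemma Measurable.ballWeight {α : Type*} [MeasurableSpace α] {f g : α → ℝ}
    (hf : Measurable f) (hg : Measurable g) : Measurable (fun a => ballWeight (f a) (g a)) :=
  measurable_ballWeight.comp (hf.prodMk hg)

lemma measurable_radialKernel : Measurable radialKernel :=
  Measurable.lintegral_prod_right' (f := fun p : ℝ × ℝ => ballWeight p.2 p.1)
    (measurable_snd.ballWeight measurable_fst)

lemma enorm_le_enorm_add_lintegral_fderiv {E : Type*} [NormedAddCommGroup E] [NormedSpace ℝ E]
    {f : E → ℝ} (hf : ContDiff ℝ 1 f) (x v : E) :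
    ‖f x‖ₑ ≤ ‖f (x + v)‖ₑ + ∫⁻ s in Set.Ioc (0 : ℝ) 1, ‖fderiv ℝ f (x + s • v)‖ₑ * ‖v‖ₑ := by
  have hcont : Continuous fun s : ℝ => fderiv ℝ f (x + s • v) v :=
    ((hf.continuous_fderiv one_ne_zero).comp (by fun_prop)).clm_apply continuous_const
  have hftc : ∫ s in (0 : ℝ)..1, fderiv ℝ f (x + s • v) v = f (x + v) - f x := by
    have h := intervalIntegral.integral_eq_sub_of_hasDerivAt
      (f := fun s : ℝ => f (x + s • v)) (f' := fun s : ℝ => fderiv ℝ f (x + s • v) v)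
      (a := 0) (b := 1) (fun s _ => ?_) (hcont.intervalIntegrable _ _)
    · simpa using h
    · have h1 : HasDerivAt (fun s : ℝ => x + s • v) v s := by
        simpa using ((hasDerivAt_id s).smul_const v).const_add x
      exact ((hf.differentiable one_ne_zero _).hasFDerivAt).comp_hasDerivAt s h1
  have hsplit : f x = f (x + v) - ∫ s in (0 : ℝ)..1, fderiv ℝ f (x + s • v) v := by
    rw [hftc]; ring
  calc ‖f x‖ₑ ≤ ‖f (x + v)‖ₑ + ‖∫ s in (0 : ℝ)..1, fderiv ℝ f (x + s • v) v‖ₑ := by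
        conv_lhs => rw [hsplit]
        exact enorm_sub_le
    _ ≤ _ := by
        gcongr
        rw [intervalIntegral.integral_of_le zero_le_one]
        exact (enorm_integral_le_lintegral_enorm _).trans
          (lintegral_mono fun s => ContinuousLinearMap.le_opENorm _ _)

lemma lintegral_ball_add_smul (h : EuclideanSpace ℝ (Fin 2) → ℝ≥0∞) (hh : Measurable h)
    (x : EuclideanSpace ℝ (Fin 2)) {s : ℝ} (hs : 0 < s) :
    ∫⁻ v in Metric.ball 0 1, h (x + s • v) = ∫⁻ y, ballWeight s (dist x y) * h y := by
  set F : EuclideanSpace ℝ (Fin 2) → ℝ≥0∞ := (Metric.ball x s).indicator h with hF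
  have hFm : Measurable F := hh.indicator measurableSet_ball
  have h1 : ∫⁻ v in Metric.ball 0 1, h (x + s • v) = ∫⁻ v, F (x + s • v) := by
    rw [← lintegral_indicator measurableSet_ball]
    refine lintegral_congr fun v => ?_
    have : x + s • v ∈ Metric.ball x s ↔ v ∈ Metric.ball 0 1 := by
      simp [norm_smul, abs_of_pos hs, hs]
    by_cases hv : v ∈ Metric.ball (0 : EuclideanSpace ℝ (Fin 2)) 1
    · rw [Set.indicator_of_mem hv, hF, Set.indicator_of_mem (this.2 hv)]
    · rw [Set.indicator_of_notMem hv, hF, Set.indicator_of_notMem (mt this.1 hv)]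
  have h2 : ∫⁻ v, F (x + s • v) = ENNReal.ofReal ((s ^ 2)⁻¹) * ∫⁻ y, F y := by
    rw [← lintegral_map (f := fun w => F (x + w)) (g := fun v => s • v)
      (hFm.comp (by fun_prop)) (by fun_prop), Measure.map_addHaar_smul _ hs.ne',
      lintegral_smul_measure, lintegral_add_left_eq_self]
    simp [abs_of_pos hs]
  rw [h1, h2, ← lintegral_const_mul _ hFm]
  refine lintegral_congr fun y => ?_
  by_cases hy : dist x y < s
  · rw [hF, Set.indicator_of_mem (by simpa [dist_comm] using hy), ballWeight, if_pos hy]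
  · rw [hF, Set.indicator_of_notMem (by simpa [dist_comm] using hy), ballWeight, if_neg hy]
    simp

lemma lintegral_mul_le_sqrt_mul_sqrt {α : Type*} [MeasurableSpace α] (μ : Measure α)
    {f g : α → ℝ≥0∞} (hf : Measurable f) (hg : Measurable g) :
    ∫⁻ a, f a * g a ∂μ ≤ (∫⁻ a, f a ^ 2 ∂μ) ^ (1 / 2 : ℝ) * (∫⁻ a, g a ^ 2 ∂μ) ^ (1 / 2 : ℝ) := by
  simpa using ENNReal.lintegral_mul_le_Lp_mul_Lq μ (p := 2) (q := 2)
    Real.HolderConjugate.two_two hf.aemeasurable hg.aemeasurable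

lemma volume_ball_mul_enorm_le {f : EuclideanSpace ℝ (Fin 2) → ℝ} (hf : ContDiff ℝ 1 f)
    (x : EuclideanSpace ℝ (Fin 2)) :
    volume (Metric.ball (0 : EuclideanSpace ℝ (Fin 2)) 1) * ‖f x‖ₑ ≤
      volume (Metric.ball (0 : EuclideanSpace ℝ (Fin 2)) 1) ^ (1 / 2 : ℝ) *
        (∫⁻ y, ‖f y‖ₑ ^ 2) ^ (1 / 2 : ℝ) +
      ∫⁻ y, radialKernel (dist x y) * ‖fderiv ℝ f y‖ₑ := by
  set B := Metric.ball (0 : EuclideanSpace ℝ (Fin 2)) 1 with hB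
  have hfd : Continuous (fderiv ℝ f) := hf.continuous_fderiv one_ne_zero
  have hD : Measurable fun y => ‖fderiv ℝ f y‖ₑ := hfd.measurable.enorm
  have hDj : Measurable (fun p : EuclideanSpace ℝ (Fin 2) × ℝ =>
      ‖fderiv ℝ f (x + p.2 • p.1)‖ₑ) := hD.comp (by fun_prop)
  have hfm : Measurable fun v => ‖f (x + v)‖ₑ :=
    (hf.continuous.comp (by fun_prop)).measurable.enorm
  have h1 : volume B * ‖f x‖ₑ ≤ ∫⁻ v in B,
      (‖f (x + v)‖ₑ + ∫⁻ s in Set.Ioc (0 : ℝ) 1, ‖fderiv ℝ f (x + s • v)‖ₑ) := by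
    rw [mul_comm, ← setLIntegral_const]
    refine setLIntegral_mono' measurableSet_ball fun v hv => ?_
    refine (enorm_le_enorm_add_lintegral_fderiv hf x v).trans ?_
    gcongr with s
    have : ‖v‖ₑ ≤ 1 := by
      rw [← ofReal_norm, ENNReal.ofReal_le_one]
      exact (mem_ball_zero_iff.1 hv).le
    exact mul_le_of_le_one_right' this
  have h2 : ∫⁻ v in B, ‖f (x + v)‖ₑ ≤
      volume B ^ (1 / 2 : ℝ) * (∫⁻ y, ‖f y‖ₑ ^ 2) ^ (1 / 2 : ℝ) := by
    have h := lintegral_mul_le_sqrt_mul_sqrt (volume.restrict B)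
      (f := fun _ => 1) measurable_const hfm
    simp only [one_mul, one_pow, lintegral_const, Measure.restrict_apply_univ] at h
    refine h.trans (mul_le_mul' le_rfl (ENNReal.rpow_le_rpow ?_ (by norm_num)))
    exact (setLIntegral_le_lintegral _ _).trans
      (lintegral_add_left_eq_self (μ := volume) (fun y => ‖f y‖ₑ ^ 2) x).le
  have h3 : ∫⁻ v in B, ∫⁻ s in Set.Ioc (0 : ℝ) 1, ‖fderiv ℝ f (x + s • v)‖ₑ =
      ∫⁻ y, radialKernel (dist x y) * ‖fderiv ℝ f y‖ₑ := by
    rw [lintegral_lintegral_swap hDj.aemeasurable,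
      setLIntegral_congr_fun measurableSet_Ioc
        fun s hs => lintegral_ball_add_smul _ hD x hs.1,
      lintegral_lintegral_swap]
    · refine lintegral_congr fun y => ?_
      rw [lintegral_mul_const _ (measurable_id'.ballWeight measurable_const)]
      rfl
    · exact ((measurable_fst.ballWeight (by fun_prop)).mul (hD.comp measurable_snd)).aemeasurable
  calc _ ≤ _ := h1
    _ = _ := lintegral_add_left hfm _
    _ ≤ _ := by rw [h3]; gcongr

lemma lintegral_ballWeight_mul_ballWeight_le (x x' : EuclideanSpace ℝ (Fin 2)) {s t : ℝ}
    (ht : 0 < t) (hts : t ≤ s) :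
    ∫⁻ y, ballWeight s (dist x y) * ballWeight t (dist x' y) ≤
      volume (Metric.ball (0 : EuclideanSpace ℝ (Fin 2)) 1) * ballWeight (2 * s) (dist x x') * 4 := by
  by_cases hd : dist x x' < 2 * s
  · have h1 : ∫⁻ y, ballWeight t (dist x' y) =
        volume (Metric.ball (0 : EuclideanSpace ℝ (Fin 2)) 1) := by
      simpa using (lintegral_ball_add_smul (fun _ => 1) measurable_const x' ht).symm
    have h2 : ballWeight (2 * s) (dist x x') * 4 = ENNReal.ofReal ((s ^ 2)⁻¹) := by
      rw [ballWeight, if_pos hd, show (4 : ℝ≥0∞) = ENNReal.ofReal 4 by simp,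
        ← ENNReal.ofReal_mul (by positivity)]
      congr 1
      rw [mul_pow, mul_inv]; ring
    rw [mul_assoc, h2, mul_comm, ← h1,
      ← lintegral_const_mul _ (measurable_const.ballWeight (by fun_prop))]
    gcongr with y
    rw [ballWeight]
    split_ifs <;> simp
  · have h0 : ∀ y, ballWeight s (dist x y) * ballWeight t (dist x' y) = 0 := by
      intro y
      by_cases h1 : dist x y < s
      · have h2 : ¬ dist x' y < t := by
          have := dist_triangle_right x x' y
          linarith
        simp [ballWeight, h2]
      · simp [ballWeight, h1]
    simp [h0]

lemma lintegral_Ioc_ballWeight_le_log {d : ℝ} (hd : 0 < d) :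
    ∫⁻ s in Set.Ioc (0 : ℝ) 1, ballWeight (2 * s) d * 4 * ENNReal.ofReal s ≤
      ENNReal.ofReal (Real.log 2 + max (Real.log (1 / d)) 0) := by
  rcases le_or_gt 2 d with h2 | h2
  · refine le_trans (le_of_eq ?_) zero_le
    rw [setLIntegral_congr_fun (g := fun _ => 0) measurableSet_Ioc]
    · simp
    · intro s hs
      simp [ballWeight, show ¬ d < 2 * s by linarith [hs.2]]
  · have hind : ∀ s ∈ Set.Ioc (0 : ℝ) 1, ballWeight (2 * s) d * 4 * ENNReal.ofReal s =
        (Set.Ioc (d / 2) 1).indicator (fun s => ENNReal.ofReal s⁻¹) s := by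
      intro s hs
      by_cases h : d < 2 * s
      · rw [Set.indicator_of_mem (by constructor <;> linarith [hs.2]), ballWeight, if_pos h,
          show (4 : ℝ≥0∞) = ENNReal.ofReal 4 by simp, ← ENNReal.ofReal_mul (by positivity),
          ← ENNReal.ofReal_mul (by positivity)]
        have := hs.1
        congr 1
        field_simp
        norm_num
      · rw [Set.indicator_of_notMem (fun h' => h (by linarith [h'.1])), ballWeight, if_neg h]
        simp
    have hint : IntegrableOn (fun s : ℝ => s⁻¹) (Set.Ioc (d / 2) 1) := by
      refine (ContinuousOn.integrableOn_Icc ?_).mono_set Set.Ioc_subset_Icc_self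
      exact continuousOn_inv₀.mono fun s hs => by
        have := hs.1
        simp only [Set.mem_compl_iff, Set.mem_singleton_iff]
        linarith
    have hnn : 0 ≤ᵐ[volume.restrict (Set.Ioc (d / 2) 1)] fun s : ℝ => s⁻¹ := by
      filter_upwards [ae_restrict_mem measurableSet_Ioc] with s hs
      have : 0 < s := by linarith [hs.1]
      positivity
    rw [setLIntegral_congr_fun measurableSet_Ioc hind]
    refine (setLIntegral_le_lintegral _ _).trans ?_
    rw [lintegral_indicator measurableSet_Ioc, ← ofReal_integral_eq_lintegral_ofReal hint hnn,
      ← intervalIntegral.integral_of_le (by linarith),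
      integral_inv_of_pos (by positivity) one_pos]
    refine ENNReal.ofReal_le_ofReal ?_
    rw [show 1 / (d / 2) = 2 * (1 / d) by field_simp, Real.log_mul two_ne_zero (by positivity)]
    gcongr
    exact le_max_left _ _

lemma lintegral_radialKernel_mul_radialKernel_le {x x' : EuclideanSpace ℝ (Fin 2)}
    (hne : x ≠ x') :
    ∫⁻ y, radialKernel (dist x y) * radialKernel (dist x' y) ≤
      2 * volume (Metric.ball (0 : EuclideanSpace ℝ (Fin 2)) 1) *
        ENNReal.ofReal (Real.log 2 + max (Real.log (1 / dist x x')) 0) := by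
  set V := volume (Metric.ball (0 : EuclideanSpace ℝ (Fin 2)) 1) with hV
  set c : ℝ → ℝ≥0∞ := fun s => V * ballWeight (2 * s) (dist x x') * 4 with hc
  have hcm : Measurable c :=
    (((by fun_prop : Measurable fun s : ℝ => 2 * s).ballWeight measurable_const).const_mul
      V).mul_const 4
  set A : ℝ → ℝ → ℝ≥0∞ := fun s t => if t ≤ s then c s else 0 with hA
  have hAm : Measurable (fun p : ℝ × ℝ => A p.1 p.2) :=
    Measurable.ite (measurableSet_le measurable_snd measurable_fst)
      (hcm.comp measurable_fst) measurable_const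
  have hA1 : ∫⁻ s in Set.Ioc (0 : ℝ) 1, ∫⁻ t in Set.Ioc (0 : ℝ) 1, A s t ≤
      V * ENNReal.ofReal (Real.log 2 + max (Real.log (1 / dist x x')) 0) := by
    refine le_trans ?_ (mul_le_mul' le_rfl (lintegral_Ioc_ballWeight_le_log (dist_pos.2 hne)))
    have hm : Measurable fun s : ℝ => ballWeight (2 * s) (dist x x') * 4 * ENNReal.ofReal s :=
      (((by fun_prop : Measurable fun s : ℝ => 2 * s).ballWeight measurable_const).mul_const 4).mul
        ENNReal.measurable_ofReal
    rw [← lintegral_const_mul _ hm]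
    refine setLIntegral_mono' measurableSet_Ioc fun s hs => ?_
    calc ∫⁻ t in Set.Ioc (0 : ℝ) 1, A s t
        ≤ ∫⁻ t, (Set.Ioc (0 : ℝ) s).indicator (fun _ => c s) t := by
          rw [← lintegral_indicator measurableSet_Ioc]
          refine lintegral_mono fun t => ?_
          by_cases ht : t ∈ Set.Ioc (0 : ℝ) 1
          · by_cases hts : t ≤ s
            · simp [hA, ht.1, hts, Set.indicator, ht.2]
            · simp [hA, hts, Set.indicator]
          · simp only [Set.indicator_of_notMem ht]; exact zero_le
      _ = _ := by
          rw [lintegral_indicator measurableSet_Ioc, setLIntegral_const, Real.volume_Ioc, sub_zero]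
          simp only [hc, mul_assoc]
  have hA2 : ∫⁻ s in Set.Ioc (0 : ℝ) 1, ∫⁻ t in Set.Ioc (0 : ℝ) 1, A t s =
      ∫⁻ s in Set.Ioc (0 : ℝ) 1, ∫⁻ t in Set.Ioc (0 : ℝ) 1, A s t :=
    lintegral_lintegral_swap (hAm.comp measurable_swap).aemeasurable
  have hst : ∀ s ∈ Set.Ioc (0 : ℝ) 1, ∀ t ∈ Set.Ioc (0 : ℝ) 1,
      ∫⁻ y, ballWeight s (dist x y) * ballWeight t (dist x' y) ≤ A s t + A t s := by
    intro s hs t ht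
    rcases le_total t s with h | h
    · refine le_trans (lintegral_ballWeight_mul_ballWeight_le x x' ht.1 h) ?_
      simp only [hA, if_pos h]
      exact le_self_add
    · have := lintegral_ballWeight_mul_ballWeight_le x' x hs.1 h
      simp only [mul_comm (ballWeight t _) (ballWeight s _), dist_comm x' x] at this
      refine this.trans ?_
      simp only [hA, if_pos h]
      exact le_add_self
  have hexp : ∫⁻ y, radialKernel (dist x y) * radialKernel (dist x' y) =
      ∫⁻ s in Set.Ioc (0 : ℝ) 1, ∫⁻ t in Set.Ioc (0 : ℝ) 1,
        ∫⁻ y, ballWeight s (dist x y) * ballWeight t (dist x' y) := by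
    have hw : ∀ z y : EuclideanSpace ℝ (Fin 2), Measurable fun s => ballWeight s (dist z y) :=
      fun z y => measurable_id'.ballWeight measurable_const
    have hj : Measurable fun p : (ℝ × EuclideanSpace ℝ (Fin 2)) × ℝ =>
        ballWeight p.1.1 (dist x p.1.2) * ballWeight p.2 (dist x' p.1.2) :=
      Measurable.mul (Measurable.ballWeight (by fun_prop) (by fun_prop))
        (Measurable.ballWeight (by fun_prop) (by fun_prop))
    calc _ = ∫⁻ y, ∫⁻ s in Set.Ioc (0 : ℝ) 1, ∫⁻ t in Set.Ioc (0 : ℝ) 1,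
          ballWeight s (dist x y) * ballWeight t (dist x' y) := by
          refine lintegral_congr fun y => ?_
          rw [lintegral_lintegral_mul (hw x y).aemeasurable (hw x' y).aemeasurable]
          rfl
      _ = ∫⁻ s in Set.Ioc (0 : ℝ) 1, ∫⁻ y, ∫⁻ t in Set.Ioc (0 : ℝ) 1,
          ballWeight s (dist x y) * ballWeight t (dist x' y) := by
          rw [lintegral_lintegral_swap]
          exact (hj.lintegral_prod_right'.comp measurable_swap).aemeasurable
      _ = _ := by
          refine lintegral_congr fun s => ?_
          rw [lintegral_lintegral_swap]
          exact Measurable.aemeasurable (Measurable.mul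
            (Measurable.ballWeight (by fun_prop) (by fun_prop))
            (Measurable.ballWeight (by fun_prop) (by fun_prop)))
  rw [hexp]
  calc _ ≤ ∫⁻ s in Set.Ioc (0 : ℝ) 1, ∫⁻ t in Set.Ioc (0 : ℝ) 1, (A s t + A t s) :=
        setLIntegral_mono' measurableSet_Ioc fun s hs =>
          setLIntegral_mono' measurableSet_Ioc fun t ht => hst s hs t ht
    _ = (∫⁻ s in Set.Ioc (0 : ℝ) 1, ∫⁻ t in Set.Ioc (0 : ℝ) 1, A s t) +
        ∫⁻ s in Set.Ioc (0 : ℝ) 1, ∫⁻ t in Set.Ioc (0 : ℝ) 1, A t s := by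
        rw [← lintegral_add_left hAm.lintegral_prod_right']
        refine lintegral_congr fun s => ?_
        exact lintegral_add_left (hAm.comp measurable_prodMk_left) _
    _ ≤ _ := by
        rw [hA2, mul_assoc, two_mul]
        gcongr

lemma measure_singleton_eq_zero_of_continuous_log_potential
    {μ : Measure (EuclideanSpace ℝ (Fin 2))}
    [IsLocallyFiniteMeasure μ]
    (hint : ∀ x : EuclideanSpace ℝ (Fin 2),
      Integrable (fun y => max (Real.log (1 / ‖x - y‖)) 0) μ)
    (hcont : Continuous (fun x : EuclideanSpace ℝ (Fin 2) =>
      ∫ y, max (Real.log (1 / ‖x - y‖)) 0 ∂μ)) (a : EuclideanSpace ℝ (Fin 2)) :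
    μ {a} = 0 := by
  by_contra ha
  have hpos : 0 < μ.real {a} :=
    ENNReal.toReal_pos ha isCompact_singleton.measure_lt_top.ne
  have hle : ∀ x, μ.real {a} * Real.log (1 / ‖x - a‖) ≤
      ∫ y, max (Real.log (1 / ‖x - y‖)) 0 ∂μ := by
    intro x
    calc μ.real {a} * Real.log (1 / ‖x - a‖)
        ≤ μ.real {a} * max (Real.log (1 / ‖x - a‖)) 0 := by gcongr; exact le_max_left _ _
      _ = ∫ y in {a}, max (Real.log (1 / ‖x - y‖)) 0 ∂μ := by
          rw [integral_singleton, smul_eq_mul]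
      _ ≤ _ := setIntegral_le_integral (hint x) (Filter.Eventually.of_forall
          fun y => le_max_right _ _)
  have hnorm : Filter.Tendsto (fun x => ‖x - a‖) (nhdsWithin a {a}ᶜ)
      (nhdsWithin (0 : ℝ) (Set.Ioi 0)) := tendsto_norm_sub_self_nhdsNE a
  have hlog : Filter.Tendsto (fun x => μ.real {a} * Real.log (1 / ‖x - a‖))
      (nhdsWithin a {a}ᶜ) Filter.atTop := by
    refine Filter.Tendsto.const_mul_atTop hpos (Real.tendsto_log_atTop.comp ?_)
    simpa only [one_div, Function.comp_def] using tendsto_inv_nhdsGT_zero.comp hnorm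
  exact not_tendsto_nhds_of_tendsto_atTop (Filter.tendsto_atTop_mono hle hlog) _
    (hcont.continuousAt.mono_left nhdsWithin_le_nhds)

lemma lintegral_sq_lintegral_radialKernel_ne_top {μ : Measure (EuclideanSpace ℝ (Fin 2))}
    [IsLocallyFiniteMeasure μ]
    (hint : ∀ x : EuclideanSpace ℝ (Fin 2),
      Integrable (fun y => max (Real.log (1 / ‖x - y‖)) 0) μ)
    (hcont : Continuous (fun x : EuclideanSpace ℝ (Fin 2) =>
      ∫ y, max (Real.log (1 / ‖x - y‖)) 0 ∂μ))
    {G : Set (EuclideanSpace ℝ (Fin 2))} (hG : IsCompact G) :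
    ∫⁻ y, (∫⁻ x in G, radialKernel (dist x y) ∂μ) ^ 2 ≠ ∞ := by
  have : IsFiniteMeasure (μ.restrict G) := ⟨by simpa using hG.measure_lt_top⟩
  obtain ⟨M, hM⟩ := (hG.image hcont).bddAbove
  set V := volume (Metric.ball (0 : EuclideanSpace ℝ (Fin 2)) 1) with hV
  have hVtop : V ≠ ∞ := measure_ball_lt_top.ne
  have hlogm : ∀ x : EuclideanSpace ℝ (Fin 2),
      Measurable fun x' => ENNReal.ofReal (max (Real.log (1 / dist x x')) 0) := fun x => by
    fun_prop
  have hK : Measurable fun p : EuclideanSpace ℝ (Fin 2) × EuclideanSpace ℝ (Fin 2) =>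
      radialKernel (dist p.1 p.2) := measurable_radialKernel.comp measurable_dist
  have hKr : ∀ y : EuclideanSpace ℝ (Fin 2), Measurable fun x => radialKernel (dist x y) :=
    fun y => measurable_radialKernel.comp (by fun_prop)
  have hj : Measurable fun p : (EuclideanSpace ℝ (Fin 2) × EuclideanSpace ℝ (Fin 2)) ×
      EuclideanSpace ℝ (Fin 2) =>
      radialKernel (dist p.1.1 p.1.2) * radialKernel (dist p.2 p.1.2) :=
    (measurable_radialKernel.comp (by fun_prop)).mul (measurable_radialKernel.comp (by fun_prop))
  have hswap : ∫⁻ y, (∫⁻ x in G, radialKernel (dist x y) ∂μ) ^ 2 =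
      ∫⁻ x in G, ∫⁻ x' in G, (∫⁻ y, radialKernel (dist x y) * radialKernel (dist x' y)) ∂μ ∂μ := by
    calc _ = ∫⁻ y, ∫⁻ x in G, ∫⁻ x' in G,
          radialKernel (dist x y) * radialKernel (dist x' y) ∂μ ∂μ := by
          refine lintegral_congr fun y => ?_
          rw [sq, lintegral_lintegral_mul (hKr y).aemeasurable (hKr y).aemeasurable]
      _ = ∫⁻ x in G, (∫⁻ y, ∫⁻ x' in G,
          radialKernel (dist x y) * radialKernel (dist x' y) ∂μ) ∂μ := by
          rw [lintegral_lintegral_swap]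
          exact (hj.lintegral_prod_right'.comp measurable_swap).aemeasurable
      _ = _ := by
          refine lintegral_congr fun x => ?_
          rw [lintegral_lintegral_swap]
          exact Measurable.aemeasurable ((measurable_radialKernel.comp (by fun_prop)).mul
            (measurable_radialKernel.comp (by fun_prop)))
  have hinner : ∀ x ∈ G, ∫⁻ x' in G,
      (∫⁻ y, radialKernel (dist x y) * radialKernel (dist x' y)) ∂μ ≤
      2 * V * (ENNReal.ofReal (Real.log 2) * μ G + ENNReal.ofReal M) := by
    intro x hx
    have hae : ∀ᵐ x' ∂(μ.restrict G), x ≠ x' := by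
      refine ae_restrict_of_ae (measure_mono_null (fun x' hx' => ?_)
        (measure_singleton_eq_zero_of_continuous_log_potential hint hcont x))
      simpa [eq_comm] using hx'
    calc _ ≤ ∫⁻ x' in G, 2 * V * (ENNReal.ofReal (Real.log 2) +
          ENNReal.ofReal (max (Real.log (1 / dist x x')) 0)) ∂μ := by
          refine lintegral_mono_ae ?_
          filter_upwards [hae] with x' hx'
          rw [← ENNReal.ofReal_add (Real.log_nonneg one_le_two) (le_max_right _ _)]
          exact lintegral_radialKernel_mul_radialKernel_le hx'
      _ = 2 * V * (ENNReal.ofReal (Real.log 2) * μ G +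
          ∫⁻ x' in G, ENNReal.ofReal (max (Real.log (1 / dist x x')) 0) ∂μ) := by
          rw [lintegral_const_mul _ ((hlogm x).const_add _),
            lintegral_add_left measurable_const, setLIntegral_const]
      _ ≤ _ := by
          gcongr
          refine (setLIntegral_le_lintegral _ _).trans ?_
          simp only [dist_eq_norm]
          rw [← ofReal_integral_eq_lintegral_ofReal (hint x)
            (Filter.Eventually.of_forall fun y => le_max_right _ _)]
          exact ENNReal.ofReal_le_ofReal (hM ⟨x, hx, rfl⟩)
  rw [hswap]
  refine ne_top_of_le_ne_top ?_ (setLIntegral_mono' hG.measurableSet hinner)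
  rw [setLIntegral_const]
  have := hG.measure_lt_top (μ := μ).ne
  finiteness

lemma exists_lintegral_enorm_le_sobolev {μ : Measure (EuclideanSpace ℝ (Fin 2))}
    [IsLocallyFiniteMeasure μ]
    (hint : ∀ x : EuclideanSpace ℝ (Fin 2),
      Integrable (fun y => max (Real.log (1 / ‖x - y‖)) 0) μ)
    (hcont : Continuous (fun x : EuclideanSpace ℝ (Fin 2) =>
      ∫ y, max (Real.log (1 / ‖x - y‖)) 0 ∂μ))
    {G : Set (EuclideanSpace ℝ (Fin 2))} (hG : IsCompact G) :
    ∃ C : ℝ≥0∞, C ≠ ∞ ∧ ∀ f : EuclideanSpace ℝ (Fin 2) → ℝ, ContDiff ℝ 1 f →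
      ∫⁻ x in G, ‖f x‖ₑ ∂μ ≤ C * ((∫⁻ y, ‖f y‖ₑ ^ 2) ^ (1 / 2 : ℝ) +
        (∫⁻ y, ‖fderiv ℝ f y‖ₑ ^ 2) ^ (1 / 2 : ℝ)) := by
  have : IsFiniteMeasure (μ.restrict G) := ⟨by simpa using hG.measure_lt_top⟩
  set V := volume (Metric.ball (0 : EuclideanSpace ℝ (Fin 2)) 1) with hV
  have hVtop : V ≠ ∞ := measure_ball_lt_top.ne
  have hV0 : V ≠ 0 := (Metric.measure_ball_pos volume _ one_pos).ne'
  set Γ := ∫⁻ y, (∫⁻ x in G, radialKernel (dist x y) ∂μ) ^ 2 with hΓ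
  have hΓtop : Γ ≠ ∞ := lintegral_sq_lintegral_radialKernel_ne_top hint hcont hG
  have hGtop : μ G ≠ ∞ := hG.measure_lt_top.ne
  refine ⟨V⁻¹ * (V ^ (1 / 2 : ℝ) * μ G + Γ ^ (1 / 2 : ℝ)), ?_, fun f hf => ?_⟩
  · have := ENNReal.inv_ne_top.2 hV0
    finiteness
  have hfm : Measurable fun x => ‖f x‖ₑ := hf.continuous.measurable.enorm
  have hD : Measurable fun y => ‖fderiv ℝ f y‖ₑ :=
    (hf.continuous_fderiv one_ne_zero).measurable.enorm
  have hK : Measurable fun p : EuclideanSpace ℝ (Fin 2) × EuclideanSpace ℝ (Fin 2) =>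
      radialKernel (dist p.1 p.2) := measurable_radialKernel.comp measurable_dist
  set F := (∫⁻ y, ‖f y‖ₑ ^ 2) ^ (1 / 2 : ℝ) with hF
  set D := (∫⁻ y, ‖fderiv ℝ f y‖ₑ ^ 2) ^ (1 / 2 : ℝ) with hDdef
  have hgrad : ∫⁻ x in G, (∫⁻ y, radialKernel (dist x y) * ‖fderiv ℝ f y‖ₑ) ∂μ ≤
      Γ ^ (1 / 2 : ℝ) * D := by
    rw [lintegral_lintegral_swap (hK.mul (hD.comp measurable_snd)).aemeasurable]
    rw [lintegral_congr fun y => lintegral_mul_const (μ := μ.restrict G) ‖fderiv ℝ f y‖ₑ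
      (f := fun x => radialKernel (dist x y)) (measurable_radialKernel.comp (by fun_prop))]
    exact lintegral_mul_le_sqrt_mul_sqrt volume hK.lintegral_prod_left' hD
  have hmain : V * ∫⁻ x in G, ‖f x‖ₑ ∂μ ≤ V ^ (1 / 2 : ℝ) * μ G * F + Γ ^ (1 / 2 : ℝ) * D := by
    rw [← lintegral_const_mul _ hfm]
    refine (lintegral_mono fun x => volume_ball_mul_enorm_le hf x).trans ?_
    rw [lintegral_add_left measurable_const, setLIntegral_const]
    refine add_le_add (le_of_eq ?_) hgrad
    ring
  calc ∫⁻ x in G, ‖f x‖ₑ ∂μ = V⁻¹ * (V * ∫⁻ x in G, ‖f x‖ₑ ∂μ) := by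
        rw [← mul_assoc, ENNReal.inv_mul_cancel hV0 hVtop, one_mul]
    _ ≤ V⁻¹ * ((V ^ (1 / 2 : ℝ) * μ G + Γ ^ (1 / 2 : ℝ)) * (F + D)) := by
        refine mul_le_mul' le_rfl (hmain.trans ?_)
        rw [add_mul, mul_add, mul_add]
        gcongr
        · exact le_self_add
        · exact le_add_self
    _ = _ := by rw [mul_assoc]

lemma toReal_sqrt_lintegral_enorm_sq {E F : Type*} [TopologicalSpace E] [MeasurableSpace E]
    [OpensMeasurableSpace E] [SecondCountableTopology E] [NormedAddCommGroup F]
    {μ : Measure E} {g : E → F} (hg : Continuous g) :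
    ((∫⁻ y, ‖g y‖ₑ ^ 2 ∂μ) ^ (1 / 2 : ℝ)).toReal = √(∫ y, ‖g y‖ ^ 2 ∂μ) := by
  have h : ∫ y, ‖g y‖ ^ 2 ∂μ = (∫⁻ y, ‖g y‖ₑ ^ 2 ∂μ).toReal := by
    have := integral_norm_eq_lintegral_enorm (μ := μ) (f := fun y => ‖g y‖ ^ 2)
      (hg.norm.pow 2).aestronglyMeasurable
    simpa [enorm_pow] using this
  rw [h, Real.sqrt_eq_rpow, ENNReal.toReal_rpow]

lemma lintegral_enorm_sq_ne_top {E F : Type*} [TopologicalSpace E] [MeasurableSpace E]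
    [OpensMeasurableSpace E] [NormedAddCommGroup F] {μ : Measure E}
    [IsFiniteMeasureOnCompacts μ] {g : E → F} (hg : Continuous g) (hs : HasCompactSupport g) :
    ∫⁻ y, ‖g y‖ₑ ^ 2 ∂μ ≠ ∞ := by
  have hs2 : HasCompactSupport fun y => ‖g y‖ ^ 2 :=
    hs.comp_left (g := fun z => ‖z‖ ^ 2) (by simp)
  simpa [HasFiniteIntegral, enorm_pow] using
    ((hg.norm.pow 2).integrable_of_hasCompactSupport (μ := μ) hs2).hasFiniteIntegral.ne

theorem finite_energy_integral (μ : Measure (EuclideanSpace ℝ (Fin 2)))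
    [IsLocallyFiniteMeasure μ]
    (hint : ∀ x : EuclideanSpace ℝ (Fin 2),
      Integrable (fun y => max (Real.log (1 / ‖x - y‖)) 0) μ)
    (hcont : Continuous (fun x : EuclideanSpace ℝ (Fin 2) =>
      ∫ y, max (Real.log (1 / ‖x - y‖)) 0 ∂μ)) :
    ∀ G : Set (EuclideanSpace ℝ (Fin 2)), IsCompact G →
      ∃ c : ℝ, 0 < c ∧
        ∀ f : EuclideanSpace ℝ (Fin 2) → ℝ, ContDiff ℝ (⊤ : ℕ∞) f → HasCompactSupport f →
          (∫ x in G, |f x| ∂μ) ≤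
            c * Real.sqrt ((1 / 2) * (∫ x, ‖gradient f x‖ ^ 2) + ∫ x, (f x) ^ 2) := by
  intro G hG
  obtain ⟨C, hC, hbound⟩ := exists_lintegral_enorm_le_sobolev hint hcont hG
  refine ⟨3 * (C.toReal + 1), by positivity, fun f hf hs => ?_⟩
  have hf1 : ContDiff ℝ 1 f := hf.of_le (by exact_mod_cast le_top)
  have hfd : Continuous (fderiv ℝ f) := hf1.continuous_fderiv one_ne_zero
  have hgrad : ∀ x, ‖gradient f x‖ = ‖fderiv ℝ f x‖ := fun x =>
    LinearIsometryEquiv.norm_map _ _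
  have hFtop := lintegral_enorm_sq_ne_top (μ := volume) hf.continuous hs
  have hDtop := lintegral_enorm_sq_ne_top (μ := volume) hfd (hs.fderiv ℝ)
  have hreal : ∫ x in G, |f x| ∂μ ≤
      C.toReal * (√(∫ x, (f x) ^ 2) + √(∫ x, ‖fderiv ℝ f x‖ ^ 2)) := by
    have h := ENNReal.toReal_mono (by finiteness) (hbound f hf1)
    rw [← integral_norm_eq_lintegral_enorm hf.continuous.aestronglyMeasurable,
      ENNReal.toReal_mul, ENNReal.toReal_add (by finiteness) (by finiteness),
      toReal_sqrt_lintegral_enorm_sq hf.continuous, toReal_sqrt_lintegral_enorm_sq hfd] at h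
    simpa using h
  simp_rw [hgrad]
  have hA : 0 ≤ ∫ x, (f x) ^ 2 := integral_nonneg fun x => sq_nonneg _
  have hB : 0 ≤ ∫ x, ‖fderiv ℝ f x‖ ^ 2 := integral_nonneg fun x => sq_nonneg _
  set A := ∫ x, (f x) ^ 2
  set B := ∫ x, ‖fderiv ℝ f x‖ ^ 2
  have h1 : √A ≤ √(1 / 2 * B + A) := Real.sqrt_le_sqrt (by linarith)
  have h2 : √B ≤ 2 * √(1 / 2 * B + A) := Real.sqrt_le_iff.2
    ⟨by positivity, by rw [mul_pow, Real.sq_sqrt (by positivity)]; linarith⟩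
  calc _ ≤ C.toReal * (√A + √B) := hreal
    _ ≤ (C.toReal + 1) * (3 * √(1 / 2 * B + A)) := by
        gcongr
        · linarith
        · linarith
    _ = _ := by ring
end

section
/- Let μ be a positive Radon (locally finite Borel) measure on ℝ² such that the map x ↦ ∫_{ℝ²} log₊(1/‖x−y‖) μ(dy) is finite and continuous on ℝ². Then for every compact set G ⊂ ℝ² there exists a constant c > 0 such that for every compact set N ⊆ G and every smooth compactly supported function f ∈ C_c^∞(ℝ²) with f ≥ 1 on an open neighborhood of N, one has μ(N) ≤ c · ( (1/2)∫_{ℝ²} ‖∇f(x)‖² dx + ∫_{ℝ²} f(x)² dx )^{1/2}. Consequently, if there exist f_n ∈ C_c^∞(ℝ²) with f_n ≥ 1 on neighborhoods of N and (1/2)∫‖∇f_n‖² dx + ∫ f_n² dx → 0, then μ(N) = 0. -/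
open MeasureTheory
open scoped ENNReal
open Metric Set

/-- Integration in polar coordinates for the Lebesgue integral of nonnegative functions. -/
theorem lintegral_eq_lintegral_toSphere {E : Type*} [NormedAddCommGroup E] [NormedSpace ℝ E]
    [FiniteDimensional ℝ E] [Nontrivial E] [MeasurableSpace E] [BorelSpace E]
    (μ : Measure E) [μ.IsAddHaarMeasure] {h : E → ℝ≥0∞} (hh : Measurable h) :
    ∫⁻ z, h z ∂μ = ∫⁻ θ : sphere (0 : E) 1, (∫⁻ r in Ioi (0 : ℝ),
      ENNReal.ofReal (r ^ (Module.finrank ℝ E - 1)) * h (r • (θ : E))) ∂μ.toSphere := by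
  have key := μ.measurePreserving_homeomorphUnitSphereProd.symm
    (homeomorphUnitSphereProd E).toMeasurableEquiv
  have hh' : Measurable fun z : ({0}ᶜ : Set E) => h z := hh.comp measurable_subtype_coe
  have hμ : ∫⁻ z, h z ∂μ = ∫⁻ p, h ((homeomorphUnitSphereProd E).toMeasurableEquiv.symm p)
      ∂μ.toSphere.prod (Measure.volumeIoiPow (Module.finrank ℝ E - 1)) := by
    rw [key.lintegral_comp hh', lintegral_subtype_comap (measurableSet_singleton _).compl,
      restrict_compl_singleton]
  have hm : Measurable fun p => h ((homeomorphUnitSphereProd E).toMeasurableEquiv.symm p) :=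
    hh'.comp key.measurable
  rw [hμ, lintegral_prod _ hm.aemeasurable]
  refine lintegral_congr fun θ => ?_
  rw [Measure.volumeIoiPow, lintegral_withDensity_eq_lintegral_mul _ (by fun_prop)
      
      (show Measurable fun r => h ((homeomorphUnitSphereProd E).toMeasurableEquiv.symm (θ, r)) from
        hm.comp measurable_prodMk_left),
    ← lintegral_subtype_comap measurableSet_Ioi]
  rfl

theorem enorm_le_setLIntegral_ray {E : Type*} [NormedAddCommGroup E] [NormedSpace ℝ E]
    {f : E → ℝ} (hf : ContDiff ℝ 1 f) (x : E) {θ : E} (hθ : ‖θ‖ = 1) :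
    ‖f x‖ₑ ≤ ∫⁻ r in Ioo (0 : ℝ) 1, (‖f (x + r • θ)‖ₑ + ‖fderiv ℝ f (x + r • θ)‖ₑ) := by
  set φ : ℝ → ℝ := fun r => (1 - r) * f (x + r • θ) with hφ
  have hφc : ContDiff ℝ 1 φ := by fun_prop
  have h := enorm_sub_le_lintegral_deriv_of_contDiffOn_Icc hφc.contDiffOn zero_le_one
  simp only [hφ, sub_self, zero_mul, sub_zero, zero_smul, add_zero, one_mul, zero_sub,
    enorm_neg] at h
  refine h.trans ?_
  rw [← restrict_Ioo_eq_restrict_Icc]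
  refine setLIntegral_mono' measurableSet_Ioo fun r hr => ?_
  have hline : HasDerivAt (fun r : ℝ => x + r • θ) θ r := by
    simpa using ((hasDerivAt_id r).smul_const θ).const_add x
  have hd : HasDerivAt φ (-1 * f (x + r • θ) + (1 - r) * fderiv ℝ f (x + r • θ) θ) r :=
    ((hasDerivAt_id r).const_sub 1).mul
      (((hf.differentiable one_ne_zero _).hasFDerivAt).comp_hasDerivAt r hline)
  rw [show (deriv (fun r => (1 - r) * f (x + r • θ)) r) = _ from hd.deriv]
  refine (enorm_add_le _ _).trans (add_le_add ?_ ?_)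
  · simp
  · rw [enorm_mul]
    calc _ ≤ 1 * ‖fderiv ℝ f (x + r • θ)‖ₑ := by
          gcongr
          · rw [← ofReal_norm, ENNReal.ofReal_le_one, Real.norm_eq_abs, abs_le]
            constructor <;> linarith [hr.1, hr.2]
          · rw [← ofReal_norm, ← ofReal_norm]
            refine ENNReal.ofReal_le_ofReal ?_
            simpa [hθ] using (fderiv ℝ f (x + r • θ)).le_opNorm θ
      _ = _ := one_mul _

theorem setLIntegral_inv_max_le {a : ℝ} (ha : 0 < a) :
    ∫⁻ r in Ioo (0 : ℝ) 1, ENNReal.ofReal (max r a)⁻¹ ≤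
      ENNReal.ofReal (1 + max (Real.log (1 / a)) 0) := by
  rcases le_total 1 a with h | h
  · calc _ ≤ ∫⁻ r in Ioo (0 : ℝ) 1, 1 := by
          refine lintegral_mono fun r => ?_
          rw [ENNReal.ofReal_le_one]
          exact inv_le_one_of_one_le₀ (h.trans (le_max_right _ _))
      _ = ENNReal.ofReal 1 := by simp
      _ ≤ _ := ENNReal.ofReal_le_ofReal (by simp)
  · have hsub : Ioo (0 : ℝ) 1 ⊆ Ioc 0 a ∪ Ioc a 1 := by
      rw [Ioc_union_Ioc_eq_Ioc ha.le h]
      exact Ioo_subset_Ioc_self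
    have hint : IntegrableOn (fun r : ℝ => r⁻¹) (Ioc a 1) := by
      rw [← intervalIntegrable_iff_integrableOn_Ioc_of_le h]
      exact intervalIntegral.intervalIntegrable_inv
        (fun r hr => by rw [uIcc_of_le h] at hr; exact (ha.trans_le hr.1).ne') continuousOn_id
    calc _ ≤ ∫⁻ r in Ioc 0 a ∪ Ioc a 1, ENNReal.ofReal (max r a)⁻¹ :=
          lintegral_mono_set hsub
      _ ≤ _ := lintegral_union_le _ _ _
      _ ≤ (∫⁻ r in Ioc 0 a, ENNReal.ofReal a⁻¹) + ∫⁻ r in Ioc a 1, ENNReal.ofReal r⁻¹ := by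
          refine add_le_add (setLIntegral_mono' measurableSet_Ioc fun r hr => ?_)
            (setLIntegral_mono' measurableSet_Ioc fun r hr => ?_)
          · rw [max_eq_right hr.2]
          · rw [max_eq_left hr.1.le]
      _ = ENNReal.ofReal 1 + ENNReal.ofReal (Real.log (1 / a)) := by
          congr 1
          · rw [setLIntegral_const, Real.volume_Ioc, ← ENNReal.ofReal_mul (by positivity), sub_zero,
              inv_mul_cancel₀ ha.ne']
          · rw [← ofReal_integral_eq_lintegral_ofReal hint, ← intervalIntegral.integral_of_le h,
              integral_inv_of_pos ha one_pos]
            filter_upwards [ae_restrict_mem measurableSet_Ioc] with r hr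
            exact inv_nonneg.2 (ha.trans hr.1).le
      _ ≤ _ := by
          rw [ENNReal.ofReal_add zero_le_one (le_max_right _ _)]
          gcongr
          exact le_max_left _ _

/-- The kernel `z ↦ 1 / ‖z‖`, truncated to the open unit ball. -/
noncomputable def truncatedInvNorm {E : Type*} [NormedAddCommGroup E] (z : E) : ℝ≥0∞ :=
  (ball (0 : E) 1).indicator (fun z => ENNReal.ofReal ‖z‖⁻¹) z

@[fun_prop]
theorem measurable_truncatedInvNorm {E : Type*} [NormedAddCommGroup E] [MeasurableSpace E]
    [BorelSpace E] : Measurable (truncatedInvNorm (E := E)) :=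
  Measurable.indicator (by fun_prop) measurableSet_ball

theorem truncatedInvNorm_mul_le {E : Type*} [NormedAddCommGroup E] {v w : E}
    (hvw : v ≠ w) :
    truncatedInvNorm v * truncatedInvNorm w ≤
      truncatedInvNorm v * ENNReal.ofReal (max ‖v‖ (‖v - w‖ / 2))⁻¹ +
      truncatedInvNorm w * ENNReal.ofReal (max ‖w‖ (‖v - w‖ / 2))⁻¹ := by
  have hd : 0 < ‖v - w‖ / 2 := by
    have := norm_pos_iff.2 (sub_ne_zero.2 hvw)
    positivity
  have hle : ∀ w : E, truncatedInvNorm w ≤ ENNReal.ofReal ‖w‖⁻¹ := fun w => indicator_le_self _ _ w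
  have htri := norm_sub_le v w
  rcases le_total ‖v‖ ‖w‖ with h | h
  · refine le_add_right (mul_le_mul_right ((hle w).trans (ENNReal.ofReal_le_ofReal ?_)) _)
    exact inv_anti₀ (lt_max_of_lt_right hd) (max_le h (by linarith))
  · rw [mul_comm]
    refine le_add_left (mul_le_mul_right ((hle v).trans (ENNReal.ofReal_le_ofReal ?_)) _)
    exact inv_anti₀ (lt_max_of_lt_right hd) (max_le h (by linarith))

section Plane

variable {E : Type*} [NormedAddCommGroup E] [NormedSpace ℝ E]
    [FiniteDimensional ℝ E] [Nontrivial E] [MeasurableSpace E] [BorelSpace E]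
    {μ : Measure E} [μ.IsAddHaarMeasure]

theorem lintegral_truncatedInvNorm_mul (hE : Module.finrank ℝ E = 2) {u : E → ℝ≥0∞}
    (hu : Measurable u) :
    ∫⁻ z, truncatedInvNorm z * u z ∂μ =
      ∫⁻ θ : sphere (0 : E) 1, (∫⁻ r in Ioo (0 : ℝ) 1, u (r • (θ : E))) ∂μ.toSphere := by
  rw [lintegral_eq_lintegral_toSphere μ (by fun_prop), hE]
  refine lintegral_congr fun θ => ?_
  rw [← lintegral_indicator measurableSet_Ioi, ← lintegral_indicator measurableSet_Ioo]
  refine lintegral_congr fun r => ?_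
  have hθ : ‖(θ : E)‖ = 1 := by simp
  by_cases h0 : 0 < r
  · rw [indicator_of_mem (show r ∈ Ioi (0 : ℝ) from h0), truncatedInvNorm]
    have hn : ‖r • (θ : E)‖ = r := by rw [norm_smul, hθ, mul_one, Real.norm_of_nonneg h0.le]
    by_cases h1 : r < 1
    · rw [indicator_of_mem (show r • (θ : E) ∈ ball (0 : E) 1 by
        rwa [mem_ball_zero_iff, hn]), indicator_of_mem (show r ∈ Ioo (0 : ℝ) 1 from ⟨h0, h1⟩), hn,
        ← mul_assoc, ← ENNReal.ofReal_mul (by positivity)]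
      simp [h0.ne']
    · rw [indicator_of_notMem (show r • (θ : E) ∉ ball (0 : E) 1 by
        rwa [mem_ball_zero_iff, hn]), indicator_of_notMem (fun h => h1 h.2)]
      simp
  · rw [indicator_of_notMem (by exact h0), indicator_of_notMem (fun h => h0 h.1)]

theorem enorm_mul_toSphere_le_lintegral (hE : Module.finrank ℝ E = 2) {f : E → ℝ}
    (hf : ContDiff ℝ 1 f) (x : E) :
    ‖f x‖ₑ * μ.toSphere univ ≤
      ∫⁻ y, truncatedInvNorm (y - x) * (‖f y‖ₑ + ‖fderiv ℝ f y‖ₑ) ∂μ := by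
  have hf0 : Continuous f := hf.continuous
  have hf1 : Continuous (fderiv ℝ f) := hf.continuous_fderiv one_ne_zero
  have hg : Continuous fun z => ‖f (x + z)‖ₑ + ‖fderiv ℝ f (x + z)‖ₑ := by fun_prop
  rw [← lintegral_add_left_eq_self _ x]
  simp only [add_sub_cancel_left]
  rw [lintegral_truncatedInvNorm_mul hE hg.measurable, ← lintegral_const]
  exact lintegral_mono fun θ => enorm_le_setLIntegral_ray hf x (by simp)

theorem lintegral_truncatedInvNorm_mul_max_le (hE : Module.finrank ℝ E = 2) {a : ℝ} (ha : 0 < a) :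
    ∫⁻ z : E, truncatedInvNorm z * ENNReal.ofReal (max ‖z‖ a)⁻¹ ∂μ ≤
      ENNReal.ofReal (1 + max (Real.log (1 / a)) 0) * μ.toSphere univ := by
  rw [lintegral_truncatedInvNorm_mul hE (by fun_prop), ← lintegral_const]
  refine lintegral_mono fun θ => ?_
  refine le_trans (le_of_eq ?_) (setLIntegral_inv_max_le ha)
  refine setLIntegral_congr_fun measurableSet_Ioo fun r hr => ?_
  simp [norm_smul, abs_of_pos hr.1]

theorem lintegral_truncatedInvNorm_mul_truncatedInvNorm_le (hE : Module.finrank ℝ E = 2) {x x' : E}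
    (hx : x ≠ x') :
    ∫⁻ y, truncatedInvNorm (y - x) * truncatedInvNorm (y - x') ∂μ ≤
      2 * μ.toSphere univ * ENNReal.ofReal (2 + max (Real.log (1 / ‖x - x'‖)) 0) := by
  have hd : 0 < ‖x - x'‖ := norm_pos_iff.2 (sub_ne_zero.2 hx)
  have hlog : Real.log (1 / (‖x - x'‖ / 2)) ≤ 1 + Real.log (1 / ‖x - x'‖) := by
    rw [show 1 / (‖x - x'‖ / 2) = 2 * (1 / ‖x - x'‖) by field_simp,
      Real.log_mul two_ne_zero (by positivity)]
    linarith [Real.log_two_lt_d9]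
  have hmax : max (Real.log (1 / (‖x - x'‖ / 2))) 0 ≤ 1 + max (Real.log (1 / ‖x - x'‖)) 0 :=
    max_le (hlog.trans (by gcongr; exact le_max_left _ _)) (by positivity)
  have hone : ∀ p : E, ∫⁻ y, truncatedInvNorm (y - p) *
      ENNReal.ofReal (max ‖y - p‖ (‖x - x'‖ / 2))⁻¹ ∂μ ≤
      ENNReal.ofReal (2 + max (Real.log (1 / ‖x - x'‖)) 0) * μ.toSphere univ := fun p => by
    rw [lintegral_sub_right_eq_self
      (fun y => truncatedInvNorm y * ENNReal.ofReal (max ‖y‖ (‖x - x'‖ / 2))⁻¹) p]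
    refine (lintegral_truncatedInvNorm_mul_max_le hE (by positivity)).trans
      (mul_le_mul_left (ENNReal.ofReal_le_ofReal ?_) _)
    linarith
  calc _ ≤ ∫⁻ y, (truncatedInvNorm (y - x) * ENNReal.ofReal (max ‖y - x‖ (‖x - x'‖ / 2))⁻¹ +
        truncatedInvNorm (y - x') * ENNReal.ofReal (max ‖y - x'‖ (‖x - x'‖ / 2))⁻¹) ∂μ := by
        refine lintegral_mono fun y => ?_
        have h := truncatedInvNorm_mul_le (v := y - x) (w := y - x') (by simpa using hx)
        rwa [sub_sub_sub_cancel_left, norm_sub_rev x' x] at h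
    _ ≤ _ := by
        rw [lintegral_add_left (by fun_prop)]
        refine (add_le_add (hone x) (hone x')).trans (le_of_eq ?_)
        ring

theorem toSphere_mul_lintegral_enorm_le (hE : Module.finrank ℝ E = 2) {f : E → ℝ}
    (hf : ContDiff ℝ 1 f) {ν : Measure E} [SFinite ν] [NullSingletonClass ν] {B : ℝ≥0∞}
    (hB : ∀ᵐ x ∂ν, ∫⁻ x', ENNReal.ofReal (2 + max (Real.log (1 / ‖x - x'‖)) 0) ∂ν ≤ B) :
    (∫⁻ x, ‖f x‖ₑ ∂ν) * μ.toSphere univ ≤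
      (∫⁻ y, (‖f y‖ₑ + ‖fderiv ℝ f y‖ₑ) ^ (2 : ℝ) ∂μ) ^ (1 / 2 : ℝ) *
        (2 * μ.toSphere univ * (B * ν univ)) ^ (1 / 2 : ℝ) := by
  have hf0 : Continuous f := hf.continuous
  have hf1 : Continuous (fderiv ℝ f) := hf.continuous_fderiv one_ne_zero
  have hg : Measurable fun z => ‖f z‖ₑ + ‖fderiv ℝ f z‖ₑ :=
    (show Continuous fun z => ‖f z‖ₑ + ‖fderiv ℝ f z‖ₑ by fun_prop).measurable
  set Φ : E → ℝ≥0∞ := fun y => ∫⁻ x, truncatedInvNorm (y - x) ∂ν with hΦ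
  have hΦm : Measurable Φ := Measurable.lintegral_prod_right (by fun_prop)
  have henergy : ∫⁻ y, Φ y ^ (2 : ℝ) ∂μ ≤ 2 * μ.toSphere univ * (B * ν univ) := by
    calc ∫⁻ y, Φ y ^ (2 : ℝ) ∂μ
        = ∫⁻ y, ∫⁻ x, ∫⁻ x', truncatedInvNorm (y - x) * truncatedInvNorm (y - x') ∂ν ∂ν ∂μ := by
          refine lintegral_congr fun y => ?_
          rw [ENNReal.rpow_two, sq, hΦ, ← lintegral_mul_const _ (by fun_prop)]
          refine lintegral_congr fun x => ?_
          rw [lintegral_const_mul _ (by fun_prop)]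
      _ = ∫⁻ x, ∫⁻ x', (∫⁻ y, truncatedInvNorm (y - x) * truncatedInvNorm (y - x') ∂μ) ∂ν ∂ν := by
          rw [lintegral_lintegral_swap]
          · refine lintegral_congr fun x => ?_
            rw [lintegral_lintegral_swap]
            fun_prop
          · refine Measurable.aemeasurable ?_
            exact Measurable.lintegral_prod_right
              (f := fun (p : E × E) (x' : E) =>
                truncatedInvNorm (p.1 - p.2) * truncatedInvNorm (p.1 - x')) (by fun_prop)
      _ ≤ ∫⁻ x, 2 * μ.toSphere univ * B ∂ν := by
          refine lintegral_mono_ae (hB.mono fun x hx => ?_)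
          refine le_trans ?_ (mul_le_mul_right hx _)
          rw [← lintegral_const_mul _ (by fun_prop)]
          have hne : ∀ᵐ x' ∂ν, x' ≠ x := by simp [ae_iff]
          exact lintegral_mono_ae (hne.mono fun x' hx' =>
            lintegral_truncatedInvNorm_mul_truncatedInvNorm_le hE hx'.symm)
      _ = _ := by rw [lintegral_const]; ring
  calc (∫⁻ x, ‖f x‖ₑ ∂ν) * μ.toSphere univ
      = ∫⁻ x, ‖f x‖ₑ * μ.toSphere univ ∂ν := (lintegral_mul_const _ (by fun_prop)).symm
    _ ≤ ∫⁻ x, ∫⁻ y, truncatedInvNorm (y - x) * (‖f y‖ₑ + ‖fderiv ℝ f y‖ₑ) ∂μ ∂ν :=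
        lintegral_mono fun x => enorm_mul_toSphere_le_lintegral hE hf x
    _ = ∫⁻ y, ((fun y => ‖f y‖ₑ + ‖fderiv ℝ f y‖ₑ) * Φ) y ∂μ := by
        rw [lintegral_lintegral_swap]
        · refine lintegral_congr fun y => ?_
          rw [lintegral_mul_const _ (by fun_prop), Pi.mul_apply, mul_comm]
        · exact Measurable.aemeasurable (by fun_prop)
    _ ≤ _ := (ENNReal.lintegral_mul_le_Lp_mul_Lq μ .two_two hg.aemeasurable
        hΦm.aemeasurable).trans (by gcongr)

end Plane

theorem measure_singleton_eq_zero_of_continuous_log_potential_s11 {E : Type*} [NormedAddCommGroup E]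
    [NormedSpace ℝ E] [Nontrivial E] [MeasurableSpace E] [BorelSpace E] {μ : Measure E}
    (hint : ∀ x, Integrable (fun y => max (Real.log (1 / ‖x - y‖)) 0) μ)
    (hcont : Continuous fun x => ∫ y, max (Real.log (1 / ‖x - y‖)) 0 ∂μ)
    {p : E} (hp : μ {p} ≠ ∞) : μ {p} = 0 := by
  by_contra h0
  have hm : 0 < μ.real {p} := ENNReal.toReal_pos h0 hp
  have : (nhdsWithin p {p}ᶜ).NeBot := Module.punctured_nhds_neBot ℝ E p
  have hlog : Filter.Tendsto (fun x => μ.real {p} * Real.log (1 / ‖x - p‖)) (nhdsWithin p {p}ᶜ)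
      Filter.atTop := by
    refine Filter.Tendsto.const_mul_atTop hm ?_
    simp only [one_div]
    exact Real.tendsto_log_atTop.comp
      (tendsto_inv_nhdsGT_zero.comp (tendsto_norm_sub_self_nhdsNE p))
  refine not_tendsto_nhds_of_tendsto_atTop (Filter.tendsto_atTop_mono (fun x => ?_) hlog) _
    (hcont.continuousAt.tendsto.mono_left nhdsWithin_le_nhds)
  calc μ.real {p} * Real.log (1 / ‖x - p‖)
      ≤ μ.real {p} * max (Real.log (1 / ‖x - p‖)) 0 := by gcongr; exact le_max_left _ _
    _ = ∫ y in {p}, max (Real.log (1 / ‖x - y‖)) 0 ∂μ := by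
        rw [integral_singleton, smul_eq_mul]
    _ ≤ _ := setIntegral_le_integral (hint x) (.of_forall fun y => le_max_right _ _)

theorem lintegral_enorm_add_fderiv_sq_le {E : Type*} [NormedAddCommGroup E] [InnerProductSpace ℝ E]
    [FiniteDimensional ℝ E] [MeasurableSpace E] [BorelSpace E] {μ : Measure E}
    [IsFiniteMeasureOnCompacts μ] {f : E → ℝ} (hf : ContDiff ℝ 1 f) (hfc : HasCompactSupport f) :
    ∫⁻ y, (‖f y‖ₑ + ‖fderiv ℝ f y‖ₑ) ^ (2 : ℝ) ∂μ ≤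
      ENNReal.ofReal (4 * ((1 / 2) * (∫ x, ‖gradient f x‖ ^ 2 ∂μ) + ∫ x, (f x) ^ 2 ∂μ)) := by
  have hf0 : Continuous f := hf.continuous
  have hf1 : Continuous (fderiv ℝ f) := hf.continuous_fderiv one_ne_zero
  have hgrad : ∀ x, ‖gradient f x‖ = ‖fderiv ℝ f x‖ := fun x => by simp [gradient]
  simp only [hgrad]
  have hsupp0 : HasCompactSupport fun x => f x ^ 2 :=
    hfc.comp_left (g := fun t : ℝ => t ^ 2) (by simp)
  have hi0 : Integrable (fun x => f x ^ 2) μ :=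
    (hf0.pow 2).integrable_of_hasCompactSupport hsupp0
  have hsupp1 : HasCompactSupport fun x => ‖fderiv ℝ f x‖ ^ 2 :=
    (hfc.fderiv ℝ).comp_left (g := fun L : E →L[ℝ] ℝ => ‖L‖ ^ 2) (by simp)
  have hi1 : Integrable (fun x => ‖fderiv ℝ f x‖ ^ 2) μ :=
    (hf1.norm.pow 2).integrable_of_hasCompactSupport hsupp1
  calc _ ≤ ∫⁻ y, ENNReal.ofReal (2 * ‖fderiv ℝ f y‖ ^ 2 + 4 * f y ^ 2) ∂μ := by
        refine lintegral_mono fun y => ?_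
        rw [← ofReal_norm, ← ofReal_norm, ← ENNReal.ofReal_add (norm_nonneg _) (norm_nonneg _),
          ENNReal.rpow_two, ← ENNReal.ofReal_pow (by positivity)]
        refine ENNReal.ofReal_le_ofReal ?_
        rw [← sq_abs (f y), Real.norm_eq_abs]
        nlinarith [sq_nonneg (|f y| - ‖fderiv ℝ f y‖), sq_nonneg (|f y|)]
    _ = _ := by
        have hsum : Integrable (fun y => 2 * ‖fderiv ℝ f y‖ ^ 2 + 4 * f y ^ 2) μ :=
          (hi1.const_mul 2).add (hi0.const_mul 4)
        rw [← ofReal_integral_eq_lintegral_ofReal hsum (.of_forall fun y => by positivity),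
          integral_add (hi1.const_mul 2) (hi0.const_mul 4), integral_const_mul, integral_const_mul]
        ring_nf

theorem exists_measure_le_mul_sqrt_energy {E : Type*} [NormedAddCommGroup E]
    [InnerProductSpace ℝ E] [FiniteDimensional ℝ E] [Nontrivial E] [MeasurableSpace E]
    [BorelSpace E] (hE : Module.finrank ℝ E = 2) {μ ν : Measure E} [μ.IsAddHaarMeasure]
    [IsLocallyFiniteMeasure ν]
    (hint : ∀ x, Integrable (fun y => max (Real.log (1 / ‖x - y‖)) 0) ν)
    (hcont : Continuous fun x => ∫ y, max (Real.log (1 / ‖x - y‖)) 0 ∂ν)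
    {G : Set E} (hG : IsCompact G) :
    ∃ c : ℝ, 0 < c ∧ ∀ N ⊆ G, IsCompact N → ∀ f : E → ℝ, ContDiff ℝ 1 f → HasCompactSupport f →
      (∀ x ∈ N, 1 ≤ f x) →
      ν N ≤ ENNReal.ofReal
        (c * Real.sqrt ((1 / 2) * (∫ x, ‖gradient f x‖ ^ 2 ∂μ) + ∫ x, (f x) ^ 2 ∂μ)) := by
  have : NullSingletonClass ν := ⟨fun p =>
    measure_singleton_eq_zero_of_continuous_log_potential_s11 hint hcont
      isCompact_singleton.measure_lt_top.ne⟩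
  obtain ⟨M, hM⟩ := hG.exists_bound_of_continuousOn hcont.continuousOn
  set M' := max M 0
  set m := ν.real G
  have hνG : ν G = ENNReal.ofReal m := (ofReal_measureReal hG.measure_lt_top.ne).symm
  set s := μ.toSphere.real univ
  have hs : μ.toSphere univ = ENNReal.ofReal s := (ofReal_measureReal (measure_ne_top _ _)).symm
  have hs0 : 0 < s := ENNReal.toReal_pos
    (by rw [Ne, Measure.measure_univ_eq_zero]; exact μ.toSphere_ne_zero) (measure_ne_top _ _)
  refine ⟨√4 * √(2 * s * ((2 * m + M') * m)) / s + 1, by positivity,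
    fun N hNG hN f hf hfc hfN => ?_⟩
  set 𝓔 := (1 / 2) * (∫ x, ‖gradient f x‖ ^ 2 ∂μ) + ∫ x, (f x) ^ 2 ∂μ
  have h𝓔 : 0 ≤ 𝓔 := by positivity
  have hB : ∀ᵐ x ∂(ν.restrict N), ∫⁻ x' in N, ENNReal.ofReal
      (2 + max (Real.log (1 / ‖x - x'‖)) 0) ∂ν ≤ ENNReal.ofReal (2 * m + M') := by
    filter_upwards [ae_restrict_mem hN.measurableSet] with x hx
    calc _ ≤ ∫⁻ x' in N, (2 + ENNReal.ofReal (max (Real.log (1 / ‖x - x'‖)) 0)) ∂ν := by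
          refine lintegral_mono fun x' => ?_
          rw [ENNReal.ofReal_add zero_le_two (le_max_right _ _)]
          simp
      _ ≤ 2 * ν G + ∫⁻ x', ENNReal.ofReal (max (Real.log (1 / ‖x - x'‖)) 0) ∂ν := by
          rw [lintegral_add_left measurable_const, setLIntegral_const]
          gcongr
          exact Measure.restrict_le_self
      _ ≤ _ := by
          rw [← ofReal_integral_eq_lintegral_ofReal (hint x) (.of_forall fun y => le_max_right _ _),
            hνG, ENNReal.ofReal_add (by positivity) (le_max_right _ _),
            ENNReal.ofReal_mul zero_le_two, ENNReal.ofReal_ofNat]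
          gcongr
          exact (Real.le_norm_self _).trans ((hM x (hNG hx)).trans (le_max_left _ _))
  have hmass : ν N ≤ ∫⁻ x in N, ‖f x‖ₑ ∂ν := by
    rw [← setLIntegral_one]
    refine setLIntegral_mono' hN.measurableSet fun x hx => ?_
    rw [← ofReal_norm, ENNReal.one_le_ofReal]
    exact (hfN x hx).trans (Real.le_norm_self _)
  have hkey : ν N * ENNReal.ofReal s ≤
      ENNReal.ofReal (√4 * √(2 * s * ((2 * m + M') * m)) * √𝓔) := by
    calc ν N * ENNReal.ofReal s
        ≤ (∫⁻ x in N, ‖f x‖ₑ ∂ν) * μ.toSphere univ := by rw [hs]; gcongr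
      _ ≤ _ := toSphere_mul_lintegral_enorm_le hE hf hB
      _ ≤ ENNReal.ofReal (4 * 𝓔) ^ (1 / 2 : ℝ) *
          ENNReal.ofReal (2 * s * ((2 * m + M') * m)) ^ (1 / 2 : ℝ) := by
          gcongr
          · exact lintegral_enorm_add_fderiv_sq_le hf hfc
          · rw [ENNReal.ofReal_mul (by positivity), ENNReal.ofReal_mul zero_le_two,
              ENNReal.ofReal_mul (by positivity), ENNReal.ofReal_ofNat, hs, ← hνG,
              Measure.restrict_apply_univ]
            gcongr
      _ = _ := by
          rw [ENNReal.ofReal_rpow_of_nonneg (by positivity) (by positivity),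
            ENNReal.ofReal_rpow_of_nonneg (by positivity) (by positivity),
            ← ENNReal.ofReal_mul (by positivity), ← Real.sqrt_eq_rpow, ← Real.sqrt_eq_rpow,
            Real.sqrt_mul (by positivity)]
          congr 1
          ring
  rw [← ENNReal.le_div_iff_mul_le (.inl (by simpa using hs0)) (.inl ENNReal.ofReal_ne_top),
    ← ENNReal.ofReal_div_of_pos hs0] at hkey
  refine hkey.trans (ENNReal.ofReal_le_ofReal ?_)
  rw [add_one_mul, div_mul_eq_mul_div]
  linarith [Real.sqrt_nonneg 𝓔]

theorem charges_no_zero_capacity_set (μ : Measure (EuclideanSpace ℝ (Fin 2)))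
    [IsLocallyFiniteMeasure μ]
    (hint : ∀ x : EuclideanSpace ℝ (Fin 2),
      Integrable (fun y => max (Real.log (1 / ‖x - y‖)) 0) μ)
    (hcont : Continuous (fun x : EuclideanSpace ℝ (Fin 2) =>
      ∫ y, max (Real.log (1 / ‖x - y‖)) 0 ∂μ)) :
    (∀ G : Set (EuclideanSpace ℝ (Fin 2)), IsCompact G →
      ∃ c : ℝ, 0 < c ∧
        ∀ N : Set (EuclideanSpace ℝ (Fin 2)), N ⊆ G → IsCompact N →
          ∀ f : EuclideanSpace ℝ (Fin 2) → ℝ, ContDiff ℝ (⊤ : ℕ∞) f → HasCompactSupport f →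
            (∃ U : Set (EuclideanSpace ℝ (Fin 2)), IsOpen U ∧ N ⊆ U ∧ ∀ x ∈ U, 1 ≤ f x) →
            μ N ≤ ENNReal.ofReal
              (c * Real.sqrt ((1 / 2) * (∫ x, ‖gradient f x‖ ^ 2) + ∫ x, (f x) ^ 2))) ∧
    (∀ N : Set (EuclideanSpace ℝ (Fin 2)), IsCompact N →
      ∀ fseq : ℕ → EuclideanSpace ℝ (Fin 2) → ℝ,
        (∀ n : ℕ, ContDiff ℝ (⊤ : ℕ∞) (fseq n) ∧ HasCompactSupport (fseq n) ∧
          ∃ U : Set (EuclideanSpace ℝ (Fin 2)), IsOpen U ∧ N ⊆ U ∧ ∀ x ∈ U, 1 ≤ fseq n x) →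
        Filter.Tendsto
          (fun n => (1 / 2) * (∫ x, ‖gradient (fseq n) x‖ ^ 2) + ∫ x, (fseq n x) ^ 2)
          Filter.atTop (nhds 0) →
        μ N = 0) := by
  have hfirst := fun (G : Set (EuclideanSpace ℝ (Fin 2))) (hG : IsCompact G) =>
    exists_measure_le_mul_sqrt_energy (by simp) (μ := volume) hint hcont hG
  have hone : (1 : WithTop ℕ∞) ≤ (⊤ : ℕ∞) := by exact_mod_cast le_top
  refine ⟨fun G hG => ?_, fun N hN fseq hfseq hlim => ?_⟩
  · obtain ⟨c, hc, h⟩ := hfirst G hG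
    refine ⟨c, hc, fun N hNG hN f hf hfc ⟨U, _, hNU, hU⟩ => ?_⟩
    exact h N hNG hN f (hf.of_le hone) hfc fun x hx => hU x (hNU hx)
  · obtain ⟨c, -, h⟩ := hfirst N hN
    have hlim' := ENNReal.tendsto_ofReal ((hlim.sqrt).const_mul c)
    rw [Real.sqrt_zero, mul_zero, ENNReal.ofReal_zero] at hlim'
    refine le_antisymm (ge_of_tendsto' hlim' fun n => ?_) zero_le
    obtain ⟨hf, hfc, U, _, hNU, hU⟩ := hfseq n
    exact h N subset_rfl hN (fseq n) (hf.of_le hone) hfc fun x hx => hU x (hNU hx)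
end
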